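/- arXiv:2203.04191 — 3 statements merged into one kernel-verified Lean document; each statement's English description precedes it below -/
import Mathlib

section
/- Let U ⊆ ℝ^d be open and f : U → ℝ a function. The following are equivalent: (1) f ∘ c ∈ Z^{0,1}(ℝ) for every c ∈ C^∞(ℝ, U); (2) f ∈ Z^{0,1}(U). -/
/-- The Zygmund class `Z^{0,1}(U)` for `U ⊆ ℝ^d`: continuous functions satisfying a second
difference estimate on every compact `K ⊆ U`. -/
def ZygmundZeroOn (d : ℕ) (f : EuclideanSpace ℝ (Fin d) → ℝ)
    (U : Set (EuclideanSpace ℝ (Fin d))) : Prop :=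
  ContinuousOn f U ∧
    ∀ K : Set (EuclideanSpace ℝ (Fin d)), K ⊆ U → IsCompact K →
      ∃ C : ℝ, ∀ x h : EuclideanSpace ℝ (Fin d), x ∈ K → x + h ∈ K → x - h ∈ K → h ≠ 0 →
        |f (x + h) - 2 * f x + f (x - h)| ≤ C * ‖h‖

/-- The Zygmund class `Z^{0,1}(ℝ)`. -/
def ZygmundZeroR (f : ℝ → ℝ) : Prop :=
  Continuous f ∧
    ∀ K : Set ℝ, IsCompact K →
      ∃ C : ℝ, ∀ x h : ℝ, x ∈ K → x + h ∈ K → x - h ∈ K → h ≠ 0 →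
        |f (x + h) - 2 * f x + f (x - h)| ≤ C * |h|

lemma zyg_exists_small (g : ℕ → ℝ → ℝ) (hg : ∀ n, ContDiff ℝ (⊤ : ℕ∞) (g n))
    (hc : ∀ n, HasCompactSupport (g n)) :
    ∃ a : ℕ → ℝ, ∀ n, 0 < a n ∧
      ∀ i ≤ n, ∀ x, a n * ‖iteratedFDeriv ℝ i (g n) x‖ ≤ (1 / 2 : ℝ) ^ n := by
  have key : ∀ n, ∃ r : ℝ, 0 < r ∧
      ∀ i ≤ n, ∀ x, r * ‖iteratedFDeriv ℝ i (g n) x‖ ≤ (1 / 2 : ℝ) ^ n := by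
    intro n
    have : ∀ i : ℕ, ∃ R, ∀ x, ‖iteratedFDeriv ℝ i (g n) x‖ ≤ R := by
      intro i
      have : BddAbove (Set.range fun x => ‖iteratedFDeriv ℝ i (g n) x‖) := by
        apply ((hg n).continuous_iteratedFDeriv
          (mod_cast le_top)).norm.bddAbove_range_of_hasCompactSupport
        apply HasCompactSupport.comp_left _ norm_zero
        apply (hc n).iteratedFDeriv
      rcases this with ⟨R, hR⟩
      exact ⟨R, fun x => hR (Set.mem_range_self _)⟩
    choose R hR using this
    have hR0 : ∀ i, 0 ≤ R i := fun i => (norm_nonneg _).trans (hR i 0)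
    set S : ℝ := 1 + ∑ i ∈ Finset.range (n + 1), R i with hS
    have hs0 : 0 ≤ ∑ i ∈ Finset.range (n + 1), R i := Finset.sum_nonneg fun i _ => hR0 i
    have hSpos : 0 < S := by linarith
    refine ⟨(1 / 2 : ℝ) ^ n / S, by positivity, fun i hi x => ?_⟩
    have h1 : R i ≤ S := by
      have := Finset.single_le_sum (f := R) (fun i _ => hR0 i)
        (Finset.mem_range.2 (Nat.lt_succ_of_le hi))
      linarith
    calc (1 / 2 : ℝ) ^ n / S * ‖iteratedFDeriv ℝ i (g n) x‖
        ≤ (1 / 2 : ℝ) ^ n / S * S := by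
          gcongr
          exact (hR i x).trans h1
      _ = (1 / 2 : ℝ) ^ n := by field_simp
  choose a ha using key
  exact ⟨a, ha⟩

lemma zyg_sum_smooth {E : Type*} [NormedAddCommGroup E] [NormedSpace ℝ E] [CompleteSpace E]
    (g : ℕ → ℝ → ℝ) (hg : ∀ n, ContDiff ℝ (⊤ : ℕ∞) (g n))
    (a : ℕ → ℝ) (ha : ∀ n, ∀ i ≤ n, ∀ x, a n * ‖iteratedFDeriv ℝ i (g n) x‖ ≤ (1 / 2 : ℝ) ^ n)
    (δ : ℝ) (hδ : 0 < δ) (p : ℕ → E) (hp : ∀ n, ‖p n‖ ≤ δ * a n) :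
    ContDiff ℝ (⊤ : ℕ∞) (fun t => ∑' n, g n t • p n) ∧
      ∀ t, ‖∑' n, g n t • p n‖ ≤ 2 * δ := by
  have hb : ∀ n, ∀ i ≤ n, ∀ x, ‖iteratedFDeriv ℝ i (fun t => g n t • p n) x‖
      ≤ δ * (1 / 2 : ℝ) ^ n := by
    intro n i hi x
    have h1 := (ContinuousLinearMap.toSpanSingleton ℝ (p n)).norm_iteratedFDeriv_comp_left
      (f := g n) (x := x) (N := (⊤ : ℕ∞)) (n := i) (hg n).contDiffAt (mod_cast le_top)
    have h2 : (⇑(ContinuousLinearMap.toSpanSingleton ℝ (p n)) ∘ g n) = fun t => g n t • p n := by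
      ext t; simp
    rw [h2, ContinuousLinearMap.norm_toSpanSingleton] at h1
    calc _ ≤ ‖p n‖ * ‖iteratedFDeriv ℝ i (g n) x‖ := h1
      _ ≤ (δ * a n) * ‖iteratedFDeriv ℝ i (g n) x‖ := by gcongr; exact hp n
      _ = δ * (a n * ‖iteratedFDeriv ℝ i (g n) x‖) := by ring
      _ ≤ _ := by gcongr; exact ha n i hi x
  have hs : HasSum (fun n : ℕ => δ * (1 / 2 : ℝ) ^ n) (2 * δ) := by
    have := hasSum_geometric_two.mul_left δ
    rwa [mul_comm δ 2] at this
  constructor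
  · refine contDiff_tsum_of_eventually (v := fun _ n => δ * (1 / 2 : ℝ) ^ n) ?_ ?_ ?_
    · intro n
      exact (hg n).smul contDiff_const
    · intro k _
      exact hs.summable
    · intro k _
      rw [Nat.cofinite_eq_atTop, Filter.eventually_atTop]
      exact ⟨k, fun n hn x => hb n k hn x⟩
  · intro t
    refine tsum_of_norm_bounded hs fun n => ?_
    have := hb n 0 (Nat.zero_le _) t
    rwa [norm_iteratedFDeriv_zero] at this

lemma zyg_pow_sep {m n : ℕ} (hmn : m ≠ n) :
    3 / 8 * (1 / 2 : ℝ) ^ m + 1 / 8 * (1 / 2 : ℝ) ^ n ≤ |(1 / 2 : ℝ) ^ n - (1 / 2 : ℝ) ^ m| := by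
  have hlt : ∀ i j : ℕ, i < j → (1 / 2 : ℝ) ^ j ≤ 1 / 2 * (1 / 2 : ℝ) ^ i := by
    intro i j hij
    rw [← pow_succ']
    exact pow_le_pow_of_le_one (by norm_num) (by norm_num) hij
  have h1 : (0 : ℝ) < (1 / 2 : ℝ) ^ m := by positivity
  have h2 : (0 : ℝ) < (1 / 2 : ℝ) ^ n := by positivity
  rcases lt_or_gt_of_ne hmn with h | h
  · have := hlt _ _ h
    rw [abs_sub_comm]
    refine le_trans ?_ (le_abs_self _)
    linarith
  · have := hlt _ _ h
    refine le_trans ?_ (le_abs_self _)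
    linarith

lemma zyg_curve (E : Type*) [NormedAddCommGroup E] [NormedSpace ℝ E] [CompleteSpace E] :
    ∃ a : ℕ → ℝ, (∀ n, 0 < a n) ∧ ∀ (δ : ℝ), 0 < δ → ∀ (x : E) (p q : ℕ → E),
      (∀ n, ‖p n‖ ≤ δ * a n) → (∀ n, ‖q n‖ ≤ δ * a n) →
      ∃ c : ℝ → E, ContDiff ℝ (⊤ : ℕ∞) c ∧ (∀ t, ‖c t - x‖ ≤ 4 * δ) ∧ c 0 = x ∧
        ∀ n s, |s| ≤ 1 / 8 * (1 / 2 : ℝ) ^ n →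
          c ((1 / 2 : ℝ) ^ n + s) = x + p n + s • q n := by
  have hpos : ∀ n : ℕ, (0 : ℝ) < (1 / 2 : ℝ) ^ n := fun n => by positivity
  let b : ∀ n : ℕ, ContDiffBump ((1 / 2 : ℝ) ^ n) := fun n =>
    { rIn := 1 / 8 * (1 / 2 : ℝ) ^ n
      rOut := 3 / 8 * (1 / 2 : ℝ) ^ n
      rIn_pos := by positivity
      rIn_lt_rOut := by have := hpos n; linarith }
  let g : ℕ → ℝ → ℝ := fun n => b n
  let k : ℕ → ℝ → ℝ := fun n t => g n t * (t - (1 / 2 : ℝ) ^ n)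
  have hg : ∀ n, ContDiff ℝ (⊤ : ℕ∞) (g n) := fun n => (b n).contDiff
  have hgc : ∀ n, HasCompactSupport (g n) := fun n => (b n).hasCompactSupport
  have hk : ∀ n, ContDiff ℝ (⊤ : ℕ∞) (k n) := fun n =>
    (hg n).mul (contDiff_id.sub contDiff_const)
  have hkc : ∀ n, HasCompactSupport (k n) := fun n => (hgc n).mul_right
  obtain ⟨a1, ha1⟩ := zyg_exists_small g hg hgc
  obtain ⟨a2, ha2⟩ := zyg_exists_small k hk hkc
  refine ⟨fun n => min (a1 n) (a2 n), fun n => lt_min (ha1 n).1 (ha2 n).1, ?_⟩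
  intro δ hδ x p q hp hq
  obtain ⟨s1, n1⟩ := zyg_sum_smooth g hg a1 (fun n => (ha1 n).2) δ hδ p
    (fun n => (hp n).trans (by gcongr; exact min_le_left _ _))
  obtain ⟨s2, n2⟩ := zyg_sum_smooth k hk a2 (fun n => (ha2 n).2) δ hδ q
    (fun n => (hq n).trans (by gcongr; exact min_le_right _ _))
  refine ⟨fun t => x + ((∑' n, g n t • p n) + ∑' n, k n t • q n),
    contDiff_const.add (s1.add s2), ?_, ?_, ?_⟩
  · intro t
    rw [add_sub_cancel_left]
    refine (norm_add_le _ _).trans ?_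
    linarith [n1 t, n2 t]
  · have h0 : ∀ n, g n 0 = 0 := by
      intro n
      apply (b n).zero_of_le_dist
      rw [Real.dist_eq, zero_sub, abs_neg, abs_of_pos (hpos n)]
      show 3 / 8 * (1 / 2 : ℝ) ^ n ≤ _
      linarith [hpos n]
    simp [h0, k]
  · intro n s hs
    have hone : g n ((1 / 2 : ℝ) ^ n + s) = 1 := by
      apply (b n).one_of_mem_closedBall
      rw [Metric.mem_closedBall, Real.dist_eq, add_sub_cancel_left]
      exact hs
    have hz : ∀ m, m ≠ n → g m ((1 / 2 : ℝ) ^ n + s) = 0 := by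
      intro m hm
      apply (b m).zero_of_le_dist
      rw [Real.dist_eq]
      show 3 / 8 * (1 / 2 : ℝ) ^ m ≤ _
      have h1 := zyg_pow_sep hm
      have h2 : |(1 / 2 : ℝ) ^ n - (1 / 2 : ℝ) ^ m|
          ≤ |(1 / 2 : ℝ) ^ n + s - (1 / 2 : ℝ) ^ m| + |s| := by
        have := abs_sub ((1 / 2 : ℝ) ^ n + s - (1 / 2 : ℝ) ^ m) s
        rwa [show (1 / 2 : ℝ) ^ n + s - (1 / 2 : ℝ) ^ m - s
          = (1 / 2 : ℝ) ^ n - (1 / 2 : ℝ) ^ m by ring] at this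
      linarith
    show x + ((∑' m, g m _ • p m) + ∑' m, k m _ • q m) = _
    rw [tsum_eq_single n, tsum_eq_single n]
    · simp only [k, hone]
      rw [add_sub_cancel_left, one_mul, one_smul, add_assoc]
    · intro m hm
      simp only [k, hz m hm, zero_mul, zero_smul]
    · intro m hm
      simp only [hz m hm, zero_smul]

lemma zyg_holder {E : Type*} [NormedAddCommGroup E] [NormedSpace ℝ E] (f : E → ℝ)
    (r M C : ℝ) (hr : 0 < r) (hM : 0 ≤ M) (hC : 0 ≤ C) (y : E)
    (hb : ∀ v : E, ‖v‖ ≤ r → |f (y + v)| ≤ M)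
    (hz : ∀ v : E, ‖v‖ ≤ r / 2 → v ≠ 0 → |f (y + v + v) - 2 * f (y + v) + f (y + v - v)| ≤ C * ‖v‖)
    (v : E) (hv : ‖v‖ ≤ r) :
    |f (y + v) - f y| ≤ (2 * C * √r + 2 * M / √(r / 2)) * √‖v‖ := by
  set A := 2 * C * √r + 2 * M / √(r / 2) with hA
  have hA1 : 2 * C * √r ≤ A := le_add_of_nonneg_right (by positivity)
  have hA2 : 2 * M / √(r / 2) ≤ A := le_add_of_nonneg_left (by positivity)
  have hA0 : 0 ≤ A := by positivity
  have key : ∀ n : ℕ, ∀ v : E, ‖v‖ ≤ r → r / 2 ^ (n + 1) < ‖v‖ →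
      |f (y + v) - f y| ≤ A * √‖v‖ := by
    intro n
    induction n with
    | zero =>
      intro v hv hv2
      have h1 := hb v hv
      have h2 := hb 0 (by simpa using hr.le)
      rw [add_zero] at h2
      have h3 : √(r / 2) ≤ √‖v‖ := Real.sqrt_le_sqrt (by simpa using hv2.le)
      have h4 : 0 < √(r / 2) := Real.sqrt_pos.2 (by positivity)
      calc |f (y + v) - f y| ≤ |f (y + v)| + |f y| := abs_sub _ _
        _ ≤ 2 * M / √(r / 2) * √(r / 2) := by
          rw [div_mul_cancel₀ _ h4.ne']; linarith
        _ ≤ A * √‖v‖ := by gcongr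
    | succ n ih =>
      intro v hv hv2
      by_cases hlt : r / 2 < ‖v‖
      · have h1 := hb v hv
        have h2 := hb 0 (by simpa using hr.le)
        rw [add_zero] at h2
        have h3 : √(r / 2) ≤ √‖v‖ := Real.sqrt_le_sqrt (by simpa using hlt.le)
        have h4 : 0 < √(r / 2) := Real.sqrt_pos.2 (by positivity)
        calc |f (y + v) - f y| ≤ |f (y + v)| + |f y| := abs_sub _ _
          _ ≤ 2 * M / √(r / 2) * √(r / 2) := by
            rw [div_mul_cancel₀ _ h4.ne']; linarith
          _ ≤ A * √‖v‖ := by gcongr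
      · push Not at hlt
        have hvpos : 0 < ‖v‖ := lt_of_le_of_lt (by positivity) hv2
        have hn : ‖v + v‖ = 2 * ‖v‖ := by
          rw [← two_smul ℝ v, norm_smul]; simp
        have h1 := ih (v + v) (by rw [hn]; linarith) (by
          rw [hn]
          have : r / 2 ^ (n + 1) = 2 * (r / 2 ^ (n + 1 + 1)) := by
            rw [pow_succ _ (n + 1)]; field_simp
          rw [this]; linarith)
        have h2 := hz v hlt (norm_pos_iff.1 hvpos)
        rw [add_sub_cancel_right, add_assoc] at h2
        rw [hn, Real.sqrt_mul (by norm_num)] at h1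
        have h3 : √2 ≤ 3 / 2 := by
          rw [Real.sqrt_le_left (by norm_num)]; norm_num
        have hs0 : 0 ≤ √‖v‖ := Real.sqrt_nonneg _
        have h4 : A * (√2 * √‖v‖) ≤ 3 / 2 * (A * √‖v‖) := by
          have := mul_le_mul_of_nonneg_right h3 (mul_nonneg hA0 hs0)
          linarith
        have h5 : C * ‖v‖ ≤ 1 / 2 * (A * √‖v‖) := by
          have e : √‖v‖ * √‖v‖ = ‖v‖ := Real.mul_self_sqrt (norm_nonneg _)
          have h6 : √‖v‖ ≤ √r := Real.sqrt_le_sqrt hv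
          calc C * ‖v‖ = C * √‖v‖ * √‖v‖ := by rw [mul_assoc, e]
            _ ≤ C * √r * √‖v‖ := by gcongr
            _ = 1 / 2 * ((2 * C * √r) * √‖v‖) := by ring
            _ ≤ _ := by gcongr
        rw [abs_le] at h1 h2 ⊢
        constructor <;> linarith [h1.1, h1.2, h2.1, h2.2]
  by_cases h0 : v = 0
  · subst h0; simp
  · have hvpos : 0 < ‖v‖ := norm_pos_iff.2 h0
    obtain ⟨n, hn⟩ := exists_pow_lt_of_lt_one (show 0 < ‖v‖ / r by positivity)
      (show (1 / 2 : ℝ) < 1 by norm_num)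
    refine key n v hv ?_
    rw [lt_div_iff₀ hr] at hn
    refine lt_of_le_of_lt ?_ hn
    rw [one_div, inv_pow, div_eq_inv_mul]
    gcongr <;> simp

lemma zyg_second_diff {E : Type*} [NormedAddCommGroup E] [NormedSpace ℝ E] (c : ℝ → E)
    (hc : ContDiff ℝ (⊤ : ℕ∞) c) (R : ℝ) :
    ∃ B : ℝ, 0 ≤ B ∧ (∀ x ∈ Set.Icc (-R) R, ∀ y ∈ Set.Icc (-R) R, ‖c x - c y‖ ≤ B * |x - y|) ∧
      ∀ x h : ℝ, x + h ∈ Set.Icc (-R) R → x - h ∈ Set.Icc (-R) R →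
        ‖c (x + h) + c (x - h) - (2 : ℝ) • c x‖ ≤ B * |h| ^ 2 := by
  have lip : ∀ g : ℝ → E, ContDiff ℝ (⊤ : ℕ∞) g → ∃ B : ℝ, 0 ≤ B ∧
      ∀ x ∈ Set.Icc (-R) R, ∀ y ∈ Set.Icc (-R) R, ‖g x - g y‖ ≤ B * |x - y| := by
    intro g hg
    have hcd : Continuous (deriv g) := hg.continuous_deriv (by simp)
    obtain ⟨B, hB⟩ := (isCompact_Icc (a := -R) (b := R)).exists_bound_of_continuousOn
      hcd.continuousOn
    refine ⟨max B 0, le_max_right _ _, fun x hx y hy => ?_⟩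
    exact (convex_Icc (-R) R).norm_image_sub_le_of_norm_deriv_le
      (fun z _ => (hg.differentiable (by simp)) z)
      (fun z hz => (hB z hz).trans (le_max_left _ _)) hy hx
  obtain ⟨B1, hB1, h1⟩ := lip c hc
  have hc' : ContDiff ℝ (⊤ : ℕ∞) (deriv c) := by
    have := (contDiff_infty_iff_deriv (𝕜 := ℝ) (f := c)).1 hc
    exact this.2
  obtain ⟨B2, hB2, h2⟩ := lip (deriv c) hc'
  refine ⟨B1 + 2 * B2, by positivity, ?_, ?_⟩
  · intro x hx y hy
    refine (h1 x hx y hy).trans ?_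
    gcongr; linarith
  · intro x h hp hm
    have hd : Differentiable ℝ c := hc.differentiable (by simp)
    let G : ℝ → E := fun s => c (x + s) + c (x - s) - (2 : ℝ) • c x
    have hG : ∀ s, HasDerivAt G (deriv c (x + s) - deriv c (x - s)) s := by
      intro s
      have e1 : HasDerivAt (fun s => c (x + s)) (deriv c (x + s)) s :=
        (hd (x + s)).hasDerivAt.comp_const_add x s
      have e2 : HasDerivAt (fun s => c (x - s)) (-deriv c (x - s)) s :=
        (hd (x - s)).hasDerivAt.comp_const_sub x s
      have := (e1.add e2).sub_const ((2 : ℝ) • c x)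
      rwa [← sub_eq_add_neg] at this
    have hin : ∀ s ∈ Set.Icc (-|h|) |h|, x + s ∈ Set.Icc (-R) R ∧ x - s ∈ Set.Icc (-R) R := by
      rintro s ⟨hs1, hs2⟩
      obtain ⟨a1, a2⟩ := hp
      obtain ⟨a3, a4⟩ := hm
      rcases abs_cases h with ⟨e, _⟩ | ⟨e, _⟩ <;> rw [e] at hs1 hs2 <;>
        refine ⟨⟨?_, ?_⟩, ⟨?_, ?_⟩⟩ <;> linarith
    have := (convex_Icc (-|h|) |h|).norm_image_sub_le_of_norm_hasDerivWithin_le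
      (f := G) (C := B2 * (2 * |h|)) (fun s _ => (hG s).hasDerivWithinAt)
      (fun s hs => by
        refine (h2 _ (hin s hs).1 _ (hin s hs).2).trans ?_
        gcongr
        rw [show x + s - (x - s) = 2 * s by ring, abs_mul, abs_two]
        exact mul_le_mul_of_nonneg_left (abs_le.2 hs) zero_le_two)
      (x := 0) (y := h) ⟨by simp, by simp⟩ ⟨neg_abs_le h, le_abs_self h⟩
    have hG0 : G 0 = 0 := by simp [G, two_smul]
    rw [hG0, sub_zero, sub_zero, Real.norm_eq_abs] at this
    refine this.trans ?_
    have : 0 ≤ B1 * |h| ^ 2 := by positivity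
    nlinarith

open Filter Topology in
lemma zyg_forward (d : ℕ)
    (U : Set (EuclideanSpace ℝ (Fin d))) (hU : IsOpen U)
    (f : EuclideanSpace ℝ (Fin d) → ℝ)
    (H : ∀ c : ℝ → EuclideanSpace ℝ (Fin d), ContDiff ℝ (⊤ : ℕ∞) c → (∀ t, c t ∈ U) →
        ZygmundZeroR (f ∘ c)) : ZygmundZeroOn d f U := by
  obtain ⟨a, ha, hcurve⟩ := zyg_curve (EuclideanSpace ℝ (Fin d))
  have hcont : ContinuousOn f U := by
    intro x hx
    apply ContinuousAt.continuousWithinAt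
    by_contra hnc
    rw [Metric.continuousAt_iff] at hnc
    push Not at hnc
    obtain ⟨ε, hε, hbad⟩ := hnc
    obtain ⟨r, hr, hrU⟩ := Metric.isOpen_iff.1 hU x hx
    have hδ : 0 < r / 8 := by positivity
    choose y hy using fun n => hbad (r / 8 * a n) (mul_pos hδ (ha n))
    obtain ⟨c, hc, hcx, hc0, hcn⟩ := hcurve (r / 8) hδ x (fun n => y n - x) (fun _ => 0)
      (fun n => by rw [← dist_eq_norm]; exact (hy n).1.le)
      (fun n => by simpa using (mul_pos hδ (ha n)).le)
    have hcU : ∀ t, c t ∈ U := fun t => hrU (by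
      rw [Metric.mem_ball, dist_eq_norm]
      linarith [hcx t])
    have hz := (H c hc hcU).1
    have ht : Tendsto (fun n : ℕ => (1 / 2 : ℝ) ^ n) atTop (𝓝 0) :=
      tendsto_pow_atTop_nhds_zero_of_lt_one (by norm_num) (by norm_num)
    have hlim := (hz.tendsto 0).comp ht
    rw [Metric.tendsto_atTop] at hlim
    obtain ⟨N, hN⟩ := hlim ε hε
    have h1 := hN N le_rfl
    have h2 : c ((1 / 2 : ℝ) ^ N) = y N := by
      have := hcn N 0 (by simp)
      simpa only [add_zero, smul_zero, add_sub_cancel] using this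
    simp only [Function.comp_apply, h2, hc0] at h1
    linarith [(hy N).2]
  refine ⟨hcont, fun K hKU hK => ?_⟩
  by_contra hno
  push Not at hno
  choose X h hX hXp hXm hne hbig using fun m : ℕ => hno m
  obtain ⟨M, hM⟩ := hK.exists_bound_of_continuousOn (hcont.mono hKU)
  simp only [Real.norm_eq_abs] at hM
  obtain ⟨x, hxK, φ, hφ, hlim⟩ := hK.tendsto_subseq hX
  have hh : Tendsto (fun m => ‖h m‖) atTop (𝓝 0) := by
    have hb : ∀ᶠ m : ℕ in atTop, ‖h m‖ ≤ 4 * M / m := by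
      filter_upwards [eventually_gt_atTop 0] with m hm
      have hm' : (0 : ℝ) < m := by exact_mod_cast hm
      rw [le_div_iff₀ hm']
      have h1 := hM _ (hX m)
      have h2 := hM _ (hXp m)
      have h3 := hM _ (hXm m)
      have h4 : |f (X m + h m) - 2 * f (X m) + f (X m - h m)| ≤ 4 * M := by
        rw [abs_le] at *
        constructor <;> linarith [h1.1, h1.2, h2.1, h2.2, h3.1, h3.2]
      have := hbig m
      linarith
    exact squeeze_zero' (Eventually.of_forall fun _ => norm_nonneg _) hb
      (tendsto_const_div_atTop_nhds_zero_nat _)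
  obtain ⟨r, hr, hrU⟩ := Metric.isOpen_iff.1 hU x (hKU hxK)
  have hδ : 0 < r / 8 := by positivity
  have hpos : ∀ n, 0 < r / 8 * a n := fun n => mul_pos hδ (ha n)
  have hsel : ∀ n : ℕ, ∃ m : ℕ, ‖X m - x‖ ≤ r / 8 * a n ∧
      ‖h m‖ / (r / 8 * a n) ≤ 1 / 8 * (1 / 2 : ℝ) ^ n ∧ (n : ℝ) / (r / 8 * a n) ≤ m := by
    intro n
    have e1 : ∀ᶠ j in atTop, dist (X (φ j)) x < r / 8 * a n :=
      (Metric.tendsto_nhds.1 hlim) _ (hpos n)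
    have e2 : ∀ᶠ j in atTop, ‖h (φ j)‖ < 1 / 8 * (1 / 2 : ℝ) ^ n * (r / 8 * a n) :=
      (hh.comp hφ.tendsto_atTop).eventually_lt_const
        (mul_pos (by positivity) (hpos n))
    have e3 : ∀ᶠ j in atTop, (n : ℝ) / (r / 8 * a n) ≤ (φ j : ℕ) :=
      (tendsto_natCast_atTop_atTop.comp hφ.tendsto_atTop).eventually_ge_atTop _
    obtain ⟨j, j1, j2, j3⟩ := (e1.and (e2.and e3)).exists
    refine ⟨φ j, ?_, ?_, j3⟩
    · rw [← dist_eq_norm]; exact j1.le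
    · rw [div_le_iff₀ (hpos n)]; exact j2.le
  choose m hm1 hm2 hm3 using hsel
  have hnpos : ∀ k, 0 < ‖h k‖ := fun k => norm_pos_iff.2 (hne k)
  obtain ⟨c, hc, hcx, hc0, hcn⟩ := hcurve (r / 8) hδ x (fun n => X (m n) - x)
    (fun n => (r / 8 * a n / ‖h (m n)‖) • h (m n)) hm1
    (fun n => by
      rw [norm_smul, Real.norm_eq_abs, abs_of_pos (div_pos (hpos n) (hnpos _)),
        div_mul_cancel₀ _ (hnpos _).ne'])
  have hcU : ∀ t, c t ∈ U := fun t => hrU (by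
    rw [Metric.mem_ball, dist_eq_norm]
    linarith [hcx t])
  obtain ⟨C, hC⟩ := (H c hc hcU).2 (Set.Icc (-2) 2) isCompact_Icc
  obtain ⟨n, hn⟩ := exists_nat_gt C
  set s := ‖h (m n)‖ / (r / 8 * a n) with hs
  have hspos : 0 < s := div_pos (hnpos _) (hpos n)
  have hq0 : (0 : ℝ) < (1 / 2 : ℝ) ^ n := by positivity
  have hq1 : (1 / 2 : ℝ) ^ n ≤ 1 := pow_le_one₀ (by norm_num) (by norm_num)
  have hs1 : s ≤ 1 / 8 * (1 / 2 : ℝ) ^ n := hm2 n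
  have hsm : s * (r / 8 * a n / ‖h (m n)‖) = 1 := by
    rw [hs]
    have := (hnpos (m n)).ne'
    have := (hpos n).ne'
    rw [div_mul_div_comm, mul_comm, div_self (mul_ne_zero ‹_› ‹_›)]
  have c0 : c ((1 / 2 : ℝ) ^ n) = X (m n) := by
    have := hcn n 0 (by simp)
    simpa only [add_zero, zero_smul, add_sub_cancel] using this
  have c1 : c ((1 / 2 : ℝ) ^ n + s) = X (m n) + h (m n) := by
    have := hcn n s (by rwa [abs_of_pos hspos])
    rw [smul_smul, hsm, one_smul] at this
    simpa only [add_sub_cancel] using this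
  have c2 : c ((1 / 2 : ℝ) ^ n - s) = X (m n) - h (m n) := by
    have := hcn n (-s) (by rwa [abs_neg, abs_of_pos hspos])
    rw [smul_smul, neg_mul, hsm, neg_one_smul, ← sub_eq_add_neg, ← sub_eq_add_neg] at this
    simpa only [add_sub_cancel] using this
  have h1 := hC ((1 / 2 : ℝ) ^ n) s ⟨by linarith, by linarith⟩ ⟨by linarith, by linarith⟩
    ⟨by linarith, by linarith⟩ hspos.ne'
  simp only [Function.comp_apply, c0, c1, c2, abs_of_pos hspos] at h1
  have h2 := hbig (m n)
  have h3 : (n : ℝ) * s ≤ m n * ‖h (m n)‖ := by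
    have := mul_le_mul_of_nonneg_right (hm3 n) (hnpos (m n)).le
    rwa [div_mul_eq_mul_div, mul_div_assoc] at this
  have h4 : C * s < n * s := mul_lt_mul_of_pos_right hn hspos
  linarith

lemma zyg_backward (d : ℕ)
    (U : Set (EuclideanSpace ℝ (Fin d))) (hU : IsOpen U)
    (f : EuclideanSpace ℝ (Fin d) → ℝ) (H : ZygmundZeroOn d f U)
    (c : ℝ → EuclideanSpace ℝ (Fin d)) (hc : ContDiff ℝ (⊤ : ℕ∞) c) (hcU : ∀ t, c t ∈ U) :
    ZygmundZeroR (f ∘ c) := by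
  obtain ⟨hf, hz⟩ := H
  refine ⟨hf.comp_continuous hc.continuous hcU, fun K hK => ?_⟩
  obtain ⟨R, hR⟩ := hK.isBounded.subset_closedBall 0
  rw [Real.closedBall_eq_Icc, zero_sub, zero_add] at hR
  obtain ⟨B, hB0, hlip, hsec⟩ := zyg_second_diff c hc R
  set L := c '' Set.Icc (-R) R with hL
  have hLc : IsCompact L := isCompact_Icc.image hc.continuous
  have hLU : L ⊆ U := by rintro _ ⟨t, _, rfl⟩; exact hcU t
  obtain ⟨r, hr, hrU⟩ := hLc.exists_cthickening_subset_open hU hLU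
  have hKc : IsCompact (Metric.cthickening r L) := hLc.cthickening
  have hmem : ∀ y ∈ L, ∀ v, ‖v‖ ≤ r → y + v ∈ Metric.cthickening r L := by
    intro y hy v hv
    exact Metric.mem_cthickening_of_dist_le _ y _ _ hy (by simpa [dist_eq_norm] using hv)
  have hself : ∀ y ∈ L, y ∈ Metric.cthickening r L := fun y hy =>
    Metric.self_subset_cthickening L hy
  obtain ⟨M, hM⟩ := hKc.exists_bound_of_continuousOn (hf.mono hrU)
  simp only [Real.norm_eq_abs] at hM
  obtain ⟨C, hC⟩ := hz _ hrU hKc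
  have hM' : ∀ y ∈ Metric.cthickening r L, |f y| ≤ max M 0 := fun y hy =>
    (hM y hy).trans (le_max_left _ _)
  have hC' : ∀ x h, x ∈ Metric.cthickening r L → x + h ∈ Metric.cthickening r L →
      x - h ∈ Metric.cthickening r L →
        |f (x + h) - 2 * f x + f (x - h)| ≤ max C 0 * ‖h‖ := by
    intro x h h1 h2 h3
    by_cases h0 : h = 0
    · subst h0
      simp only [add_zero, sub_zero, norm_zero, mul_zero]
      rw [show f x - 2 * f x + f x = 0 by ring, abs_zero]
    · refine (hC x h h1 h2 h3 h0).trans ?_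
      gcongr
      exact le_max_left _ _
  set M' := max M 0
  set C' := max C 0
  have hM0 : 0 ≤ M' := le_max_right _ _
  have hC0 : 0 ≤ C' := le_max_right _ _
  set A := 2 * C' * √r + 2 * M' / √(r / 2) with hA
  have hA0 : 0 ≤ A := by positivity
  have hhol : ∀ y ∈ L, ∀ v, ‖v‖ ≤ r → |f (y + v) - f y| ≤ A * √‖v‖ := by
    intro y hy v hv
    refine zyg_holder f r M' C' hr hM0 hC0 y (fun v hv => hM' _ (hmem y hy v hv)) ?_ v hv
    intro v hv _
    refine hC' _ _ (hmem y hy v (by linarith)) ?_ ?_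
    · rw [add_assoc]
      refine hmem y hy _ ((norm_add_le _ _).trans (by linarith))
    · rw [add_sub_cancel_right]
      exact hself y hy
  -- the threshold for `h`
  set h0 := √(r / (B + 1)) with hh0
  have hB1 : 0 < B + 1 := by linarith
  have hh0pos : 0 < h0 := Real.sqrt_pos.2 (by positivity)
  refine ⟨4 * M' / h0 + C' * B + 2 * A * √(B + 1), fun x h hx hxp hxm hne => ?_⟩
  have hab : 0 < |h| := abs_pos.2 hne
  simp only [Function.comp_apply]
  have lx : c x ∈ L := ⟨x, hR hx, rfl⟩
  have lp : c (x + h) ∈ L := ⟨_, hR hxp, rfl⟩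
  have lm : c (x - h) ∈ L := ⟨_, hR hxm, rfl⟩
  by_cases hlarge : h0 ≤ |h|
  · have h1 := hM' _ (hself _ lx)
    have h2 := hM' _ (hself _ lp)
    have h3 := hM' _ (hself _ lm)
    have h4 : |f (c (x + h)) - 2 * f (c x) + f (c (x - h))| ≤ 4 * M' := by
      rw [abs_le] at *
      constructor <;> linarith [h1.1, h1.2, h2.1, h2.2, h3.1, h3.2]
    calc _ ≤ 4 * M' := h4
      _ = 4 * M' / h0 * h0 := by field_simp
      _ ≤ 4 * M' / h0 * |h| := by gcongr
      _ ≤ _ := by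
        apply mul_le_mul_of_nonneg_right _ hab.le
        have : 0 ≤ C' * B := by positivity
        have : 0 ≤ 2 * A * √(B + 1) := by positivity
        linarith
  · push Not at hlarge
    set v := (1 / 2 : ℝ) • (c (x + h) + c (x - h) - (2 : ℝ) • c x) with hv
    set k := (1 / 2 : ℝ) • (c (x + h) - c (x - h)) with hk
    have hvn : ‖v‖ ≤ (B + 1) * |h| ^ 2 := by
      rw [hv, norm_smul]
      have := hsec x h (hR hxp) (hR hxm)
      have h5 : ‖(1 / 2 : ℝ)‖ = 1 / 2 := by norm_num
      rw [h5]
      have : 0 ≤ B * |h| ^ 2 := by positivity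
      nlinarith [sq_nonneg |h|]
    have hvr : ‖v‖ ≤ r := by
      refine hvn.trans ?_
      have h6 : |h| ^ 2 ≤ h0 ^ 2 := by gcongr
      rw [hh0, Real.sq_sqrt (by positivity)] at h6
      calc (B + 1) * |h| ^ 2 ≤ (B + 1) * (r / (B + 1)) := by gcongr
        _ = r := by field_simp
    have hkn : ‖k‖ ≤ B * |h| := by
      rw [hk, norm_smul]
      have := hlip _ (hR hxp) _ (hR hxm)
      rw [show x + h - (x - h) = 2 * h by ring, abs_mul, abs_two] at this
      have h5 : ‖(1 / 2 : ℝ)‖ = 1 / 2 := by norm_num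
      rw [h5]
      linarith
    have ep : c x + v + k = c (x + h) := by
      rw [hv, hk]; module
    have em : c x + v - k = c (x - h) := by
      rw [hv, hk]; module
    have h7 := hC' (c x + v) k (hmem _ lx _ hvr) (by rw [ep]; exact hself _ lp)
      (by rw [em]; exact hself _ lm)
    rw [ep, em] at h7
    have h8 := hhol _ lx v hvr
    have h9 : √‖v‖ ≤ √(B + 1) * |h| := by
      calc √‖v‖ ≤ √((B + 1) * |h| ^ 2) := Real.sqrt_le_sqrt hvn
        _ = √(B + 1) * |h| := by
          rw [Real.sqrt_mul hB1.le, Real.sqrt_sq hab.le]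
    have h10 : |f (c x + v) - f (c x)| ≤ A * √(B + 1) * |h| := by
      refine h8.trans ?_
      rw [mul_assoc]
      gcongr
    have h11 : C' * ‖k‖ ≤ C' * B * |h| := by
      rw [mul_assoc]; gcongr
    have h12 : 0 ≤ 4 * M' / h0 * |h| := by positivity
    have h13 := h7.trans h11
    rw [abs_le] at h13 h10 ⊢
    constructor <;> linarith [h13.1, h13.2, h10.1, h10.2]

/-- **Lemma 3.3.** For `U ⊆ ℝ^d` open and `f : U → ℝ`, `f ∘ c ∈ Z^{0,1}(ℝ)` for every smooth
curve `c : ℝ → U` if and only if `f ∈ Z^{0,1}(U)`. -/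
theorem zygmund_zero_testing_on_smooth_curves (d : ℕ)
    (U : Set (EuclideanSpace ℝ (Fin d))) (hU : IsOpen U)
    (f : EuclideanSpace ℝ (Fin d) → ℝ) :
    (∀ c : ℝ → EuclideanSpace ℝ (Fin d), ContDiff ℝ (⊤ : ℕ∞) c → (∀ t, c t ∈ U) →
        ZygmundZeroR (f ∘ c)) ↔
      ZygmundZeroOn d f U :=
  ⟨fun H => zyg_forward d U hU f H, fun H c hc hcU => zyg_backward d U hU f H c hc hcU⟩
end

section
/- Let m ≥ 1 be an integer and let f : ℝ² → ℝ be such that f ∘ c ∈ Z^{m,1}(ℝ) for every c ∈ C^∞(ℝ, ℝ²). Then for every x ∈ ℝ the partial derivative ∂₂f(x,0) = (d/ds)|_{s=0} f(x,s) exists, and the function x ↦ ∂₂f(x,0) belongs to Z^{m−1,1}(ℝ). -/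
/-- The local Zygmund class `Z^{m,1}(ℝ)`: `C^m` functions whose `m`-th derivative satisfies a
Zygmund (second difference) estimate on every compact set. -/
def ZygmundClassR (m : ℕ) (f : ℝ → ℝ) : Prop :=
  ContDiff ℝ m f ∧
    ∀ K : Set ℝ, IsCompact K →
      ∃ C : ℝ, ∀ x h : ℝ, x ∈ K → x + h ∈ K → x - h ∈ K → h ≠ 0 →
        |iteratedDeriv m f (x + h) - 2 * iteratedDeriv m f x + iteratedDeriv m f (x - h)|
          ≤ C * |h|


open Polynomial in
/-- numerical differentiation polynomial -/
lemma zyg_exists_poly (n : ℕ) : ∃ L : ℝ[X], (X - 1) ∣ L ∧ (derivative L).eval 1 = 1 ∧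
    (X - 1) ^ (n + 2) ∣ L.comp (X ^ 2) - 2 * L := by
  induction n with
  | zero =>
    refine ⟨X - 1, dvd_rfl, by simp, 1, ?_⟩
    simp; ring
  | succ n ih =>
    obtain ⟨L, h1, h2, r, hr⟩ := ih
    set c : ℝ := - r.eval 1 / (2 ^ (n + 2) - 2) with hc
    have hpos : (2:ℝ) ^ (n + 2) - 2 ≠ 0 := by
      have : (1:ℝ) ≤ 2 ^ n := one_le_pow₀ (by norm_num)
      rw [pow_add]; nlinarith
    have hd : (X - 1 : ℝ[X]) ∣ r + C c * ((X + 1) ^ (n + 2) - 2) := by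
      have := (dvd_iff_isRoot (p := r + C c * ((X + 1) ^ (n + 2) - 2)) (a := 1)).2
        (by simp [hc]; norm_num; field_simp; simp)
      simpa using this
    obtain ⟨s, hs⟩ := hd
    refine ⟨L + C c * (X - 1) ^ (n + 2), ?_, ?_, s, ?_⟩
    · exact dvd_add h1 (Dvd.dvd.mul_left (dvd_pow_self _ (by omega)) _)
    · simp [h2, derivative_pow]
    · have : (X ^ 2 - 1 : ℝ[X]) ^ (n + 2) = (X - 1) ^ (n + 2) * (X + 1) ^ (n + 2) := by
        rw [← mul_pow]; ring
      simp only [add_comp, mul_comp, C_comp, pow_comp, sub_comp, X_comp, one_comp]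
      rw [this, show n + 1 + 2 = (n + 2) + 1 by ring, pow_succ (X - 1 : ℝ[X]) (n + 2), mul_assoc, ← hs]
      linear_combination hr

/-- translation action of the group algebra -/
noncomputable def zygAct (M : Type*) [AddCommGroup M] :
    AddMonoidAlgebra ℝ M →ₐ[ℝ] Module.End ℝ (M → ℝ) :=
  AddMonoidAlgebra.lift ℝ _ M
    { toFun := fun v => LinearMap.funLeft ℝ ℝ (fun x => x + v.toAdd)
      map_one' := by ext; simp [LinearMap.funLeft]
      map_mul' := fun v w => by
        ext φ x; simp [LinearMap.funLeft]; congr 1; abel }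

/-- the translation by `v` -/
noncomputable abbrev zygE {M : Type*} [AddCommGroup M] (v : M) : AddMonoidAlgebra ℝ M :=
  AddMonoidAlgebra.single v 1

section
variable {M : Type*} [AddCommGroup M]

lemma zygE_mul (v w : M) : zygE v * zygE w = zygE (v + w) := by simp [zygE]
lemma zygE_zero : zygE (0 : M) = 1 := rfl
lemma zygE_pow (v : M) (k : ℕ) : zygE v ^ k = zygE (k • v) := by simp [zygE]

lemma zygAct_E (v : M) (φ : M → ℝ) (x : M) : zygAct M (zygE v) φ x = φ (x + v) := by
  simp [zygAct, zygE, LinearMap.funLeft]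

lemma zygAct_diff (v : M) (k : ℕ) (φ : M → ℝ) :
    zygAct M ((zygE v - 1) ^ k) φ = (fwdDiff v)^[k] φ := by
  induction k with
  | zero => simp
  | succ k ih =>
    rw [pow_succ', map_mul, Module.End.mul_apply, ih, Function.iterate_succ_apply']
    ext x
    simp [fwdDiff, zygAct_E, -AddMonoidAlgebra.single_sub]

lemma zygAct_poly (v : M) (p : Polynomial ℝ) (φ : M → ℝ) (x : M) :
    zygAct M (Polynomial.aeval (zygE v) p) φ x = p.sum fun i a => a * φ (x + i • v) := by
  rw [Polynomial.aeval_eq_sum_range, Polynomial.sum_over_range _ (by simp), map_sum,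
    LinearMap.sum_apply, Finset.sum_apply]
  refine Finset.sum_congr rfl fun i _ => ?_
  rw [zygE_pow, map_smul, LinearMap.smul_apply, Pi.smul_apply, zygAct_E, smul_eq_mul]

lemma zygAct_bound (v : M) (p : Polynomial ℝ) (φ : M → ℝ) (B : ℝ) (hB : ∀ x, |φ x| ≤ B) (x : M) :
    |zygAct M (Polynomial.aeval (zygE v) p) φ x| ≤ (p.sum fun _ a => |a|) * B := by
  rw [zygAct_poly, Polynomial.sum, Polynomial.sum, Finset.sum_mul]
  refine (Finset.abs_sum_le_sum_abs _ _).trans (Finset.sum_le_sum fun i _ => ?_)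
  rw [abs_mul]
  exact mul_le_mul_of_nonneg_left (hB _) (abs_nonneg _)

lemma zyg_fwdDiff_bound (v : M) (k : ℕ) (φ : M → ℝ) (B : ℝ) (hB : ∀ x, |φ x| ≤ B) (x : M) :
    |(fwdDiff v)^[k] φ x| ≤ 2 ^ k * B := by
  induction k generalizing x with
  | zero => simpa using hB x
  | succ k ih =>
    rw [Function.iterate_succ_apply']
    have h1 := abs_sub ((fwdDiff v)^[k] φ (x + v)) ((fwdDiff v)^[k] φ x)
    have h2 := ih x
    have h3 := ih (x + v)
    simp only [fwdDiff] at *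
    rw [pow_succ]; linarith

/-- Kemperman polarization identity in the group algebra. -/
lemma zyg_polar [Module ℝ M] (n : ℕ) (h : ℕ → M) :
    ∏ j ∈ Finset.range n, (zygE (h j) - 1) =
      ∑ s ∈ (Finset.range n).powerset, (-1) ^ s.card * (zygE (∑ j ∈ s, h j) *
        (zygE (-∑ j ∈ s, ((j : ℝ) + 1)⁻¹ • h j) - 1) ^ n) := by
  have hprod : ∀ (s : Finset ℕ) (g : ℕ → M), zygE (∑ j ∈ s, g j) = ∏ j ∈ s, zygE (g j) := by
    intro s g
    classical
    induction s using Finset.induction_on with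
    | empty => rfl
    | insert a s ha ih => rw [Finset.sum_insert ha, Finset.prod_insert ha, ← ih, zygE_mul]
  have key : ∀ s ∈ (Finset.range n).powerset, (-1) ^ s.card * (zygE (∑ j ∈ s, h j) *
        (zygE (-∑ j ∈ s, ((j : ℝ) + 1)⁻¹ • h j) - 1) ^ n) =
      ∑ k ∈ Finset.range (n + 1), (-1) ^ (n - k) * (n.choose k : AddMonoidAlgebra ℝ M) *
        ∏ j ∈ s, (- zygE ((1 - k * ((j : ℝ) + 1)⁻¹) • h j)) := by
    intro s _
    rw [sub_eq_add_neg, add_pow, Finset.mul_sum, Finset.mul_sum]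
    refine Finset.sum_congr rfl fun k _ => ?_
    rw [Finset.prod_neg, ← hprod, zygE_pow]
    have : zygE (∑ j ∈ s, (1 - k * ((j : ℝ) + 1)⁻¹) • h j) =
        zygE (∑ j ∈ s, h j) * zygE (k • -∑ j ∈ s, ((j : ℝ) + 1)⁻¹ • h j) := by
      rw [zygE_mul]; congr 1
      simp only [sub_smul, one_smul, Finset.sum_sub_distrib, mul_smul, ← Finset.smul_sum]
      rw [smul_neg, sub_eq_add_neg, Nat.cast_smul_eq_nsmul]
    rw [this]; ring
  rw [Finset.sum_congr rfl key, Finset.sum_comm]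
  simp_rw [← Finset.mul_sum, ← Finset.prod_one_add]
  rw [Finset.sum_eq_single 0]
  · simp only [Nat.sub_zero, Nat.choose_zero_right, Nat.cast_one, mul_one, Nat.cast_zero, zero_mul,
      sub_zero, one_smul]
    have : ∀ j, (1 + - zygE (h j)) = -(zygE (h j) - 1) := fun j => by ring
    simp_rw [this]
    rw [Finset.prod_neg, ← mul_assoc, Finset.card_range, ← mul_pow]; simp
  · intro k hk hk0
    have : ∏ j ∈ Finset.range n, (1 + - zygE ((1 - k * ((j : ℝ) + 1)⁻¹) • h j)) = 0 := by
      apply Finset.prod_eq_zero (i := k - 1)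
      · simp at hk ⊢; omega
      · have : ((k - 1 : ℕ) : ℝ) + 1 = k := by
          rw [Nat.cast_sub (by omega)]; simp
        rw [this, mul_inv_cancel₀ (by exact_mod_cast hk0)]
        simp [zygE_zero]
    rw [this, mul_zero]
  · simp

end


/-- numerical derivative in direction `w` at scale `h` -/
noncomputable def zygD {M : Type*} [AddCommGroup M] [Module ℝ M] (L : Polynomial ℝ) (w : M) (h : ℝ)
    (φ : M → ℝ) (x : M) : ℝ := zygAct M (Polynomial.aeval (zygE (h • w)) L) φ x / h

section
variable {M : Type*} [AddCommGroup M] [Module ℝ M]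

lemma zygD_half (n : ℕ) (L : Polynomial ℝ)
    (hL : (Polynomial.X - 1) ^ (n + 2) ∣ L.comp (Polynomial.X ^ 2) - 2 * L) :
    ∃ K : ℝ, 0 ≤ K ∧ ∀ (M : Type) [AddCommGroup M] [Module ℝ M] (φ : M → ℝ) (w : M) (C : ℝ),
      (∀ h : ℝ, 0 < h → ∀ x, |(fwdDiff (h • w))^[n + 2] φ x| ≤ C * h ^ (n + 1)) →
      ∀ h : ℝ, 0 < h → ∀ x, |zygD L w h φ x - zygD L w (h / 2) φ x| ≤ K * C * h ^ n := by
  obtain ⟨r, hr⟩ := hL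
  refine ⟨r.sum fun _ a => |a|, Finset.sum_nonneg fun _ _ => abs_nonneg _, ?_⟩
  intro M _ _ φ w C hC h hh x
  have hC0 : 0 ≤ C := by
    have := (abs_nonneg _).trans (hC 1 one_pos 0); simpa using this
  have hK0 : 0 ≤ (r.sum fun _ a => |a|) := Finset.sum_nonneg fun _ _ => abs_nonneg _
  set v : M := (h / 2) • w with hv
  have e1 : zygE (h • w) = zygE v ^ 2 := by
    rw [zygE_pow, hv, ← Nat.cast_smul_eq_nsmul ℝ, smul_smul]; congr 2; push_cast; ring
  have e2 : Polynomial.aeval (zygE (h • w)) L - 2 * Polynomial.aeval (zygE v) L =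
      Polynomial.aeval (zygE v) r * (zygE v - 1) ^ (n + 2) := by
    have := congrArg (Polynomial.aeval (zygE v)) hr
    rw [e1]
    simp only [map_sub, map_mul, map_pow, Polynomial.aeval_comp, Polynomial.aeval_X, map_one,
      map_ofNat] at this
    rw [this]; ring
  have e3 : zygAct M (Polynomial.aeval (zygE (h • w)) L) φ x
      - 2 * zygAct M (Polynomial.aeval (zygE v) L) φ x =
      zygAct M (Polynomial.aeval (zygE v) r) ((fwdDiff v)^[n + 2] φ) x := by
    have := congrFun (congrArg (fun a => zygAct M a φ) e2) x
    rw [← zygAct_diff, ← Module.End.mul_apply, ← map_mul, ← this]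
    have h3 : ∀ a b : AddMonoidAlgebra ℝ M,
        zygAct M (a - 2 * b) φ x = zygAct M a φ x - 2 * zygAct M b φ x := by
      intro a b
      rw [two_mul, map_sub, map_add, LinearMap.sub_apply, LinearMap.add_apply, Pi.sub_apply,
        Pi.add_apply, two_mul]
    exact (h3 _ _).symm
  have e4 := zygAct_bound v r ((fwdDiff v)^[n + 2] φ) _ (hC (h / 2) (by positivity)) x
  rw [← e3] at e4
  have e5 : zygD L w h φ x - zygD L w (h / 2) φ x = (zygAct M (Polynomial.aeval (zygE (h • w)) L) φ x
      - 2 * zygAct M (Polynomial.aeval (zygE v) L) φ x) / h := by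
    unfold zygD; field_simp; rfl
  rw [e5, abs_div, abs_of_pos hh, div_le_iff₀ hh]
  refine e4.trans ?_
  rw [mul_assoc, mul_assoc]
  gcongr
  rw [← pow_succ]
  gcongr
  linarith

lemma zygD_tendsto (L : Polynomial ℝ) (h1 : (Polynomial.X - 1) ∣ L)
    (h2 : (Polynomial.derivative L).eval 1 = 1) (w : M) (φ : M → ℝ) (x : M) (d : ℝ)
    (hd : HasDerivAt (fun s : ℝ => φ (x + s • w)) d 0) (h : ℝ) (hh : 0 < h) :
    Filter.Tendsto (fun k : ℕ => zygD L w (h / 2 ^ k) φ x) Filter.atTop (nhds d) := by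
  have hL1 : L.eval 1 = 0 := by
    have := (Polynomial.dvd_iff_isRoot (p := L) (a := 1)).1 (by simpa using h1)
    exact this
  set F : ℝ → ℝ := fun t => zygAct M (Polynomial.aeval (zygE (t • w)) L) φ x with hF
  have hFd : HasDerivAt F d 0 := by
    have e : F = fun t : ℝ => ∑ i ∈ L.support, L.coeff i * φ (x + ((i : ℝ) * t) • w) := by
      ext t; simp only [hF, zygAct_poly, Polynomial.sum]
      refine Finset.sum_congr rfl fun i _ => ?_
      rw [← Nat.cast_smul_eq_nsmul ℝ, smul_smul]
    have e2 : d = ∑ i ∈ L.support, L.coeff i * (d * i) := by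
      rw [Polynomial.derivative_eval, Polynomial.sum] at h2
      simp at h2
      calc d = d * 1 := by ring
        _ = _ := by rw [← h2, Finset.mul_sum]; exact Finset.sum_congr rfl fun i _ => by ring
    rw [e]; rw [e2]
    refine HasDerivAt.fun_sum fun i _ => HasDerivAt.const_mul _ ?_
    have hm : HasDerivAt (fun t : ℝ => (i : ℝ) * t) i 0 := by
      simpa using (hasDerivAt_id (0:ℝ)).const_mul (i:ℝ)
    have hd' : HasDerivAt (fun s : ℝ => φ (x + s • w)) d ((i:ℝ) * 0) := by simpa using hd
    exact hd'.comp 0 hm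
  have hF0 : F 0 = 0 := by
    simp only [hF, zygAct_poly, zero_smul, smul_zero, add_zero, Polynomial.sum]
    rw [← Finset.sum_mul]
    rw [Polynomial.eval_eq_sum, Polynomial.sum] at hL1
    simp at hL1
    rw [hL1, zero_mul]
  have := hasDerivAt_iff_tendsto_slope_zero.1 hFd
  have ht : Filter.Tendsto (fun k : ℕ => h / 2 ^ k) Filter.atTop (nhdsWithin 0 {0}ᶜ) := by
    rw [tendsto_nhdsWithin_iff]
    refine ⟨?_, Filter.Eventually.of_forall fun k => ?_⟩
    · have := (tendsto_pow_atTop_nhds_zero_of_lt_one (r := (1/2:ℝ)) (by norm_num) (by norm_num)).const_mul h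
      simpa [div_eq_mul_inv] using this
    · simp; positivity
  refine (this.comp ht).congr fun k => ?_
  simp only [Function.comp_apply, hF0, zero_add, sub_zero, zygD, smul_eq_mul]
  exact (div_eq_inv_mul _ _).symm

lemma zyg_tele (n : ℕ) (hn : 1 ≤ n) (B h : ℝ) (hB : 0 ≤ B) (hh : 0 < h) (D : ℝ → ℝ)
    (hD : ∀ h : ℝ, 0 < h → |D h - D (h / 2)| ≤ B * h ^ n) (k : ℕ) :
    dist (D (h / 2 ^ k)) (D (h / 2 ^ (k + 1))) ≤ (2 * B * h ^ n) / 2 / 2 ^ k := by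
  have := hD (h / 2 ^ k) (by positivity)
  rw [div_div, ← pow_succ] at this
  rw [Real.dist_eq]
  refine this.trans ?_
  rw [div_pow, mul_assoc 2, mul_div_cancel_left₀ _ (two_ne_zero), mul_div_assoc]
  gcongr
  exact le_self_pow₀ (one_le_pow₀ (by norm_num)) (by omega)

end

/-- main difference transfer -/
lemma zyg_transfer (n : ℕ) (hn : 1 ≤ n) (L : Polynomial ℝ) (h1 : (Polynomial.X - 1) ∣ L)
    (h2 : (Polynomial.derivative L).eval 1 = 1)
    (hL : (Polynomial.X - 1) ^ (n + 2) ∣ L.comp (Polynomial.X ^ 2) - 2 * L)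
    (M : Type) [AddCommGroup M] [Module ℝ M] (φ φ1 : M → ℝ) (w u : M) (C C2 : ℝ)
    (hC : ∀ h : ℝ, 0 < h → ∀ x, |(fwdDiff (h • w))^[n + 2] φ x| ≤ C * h ^ (n + 1))
    (hd : ∀ x, HasDerivAt (fun s : ℝ => φ (x + s • w)) (φ1 x) 0)
    (hC2 : ∀ h : ℝ, 0 < h → ∀ x, |fwdDiff (h • w) ((fwdDiff (h • u))^[n + 1] φ) x| ≤ C2 * h ^ (n + 1)) :
    (∃ B : ℝ, ∀ h : ℝ, 0 < h → ∀ x, |zygD L w h φ x - φ1 x| ≤ B * h ^ n) ∧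
    ∃ C' : ℝ, ∀ h : ℝ, 0 < h → ∀ x, |(fwdDiff (h • u))^[n + 1] φ1 x| ≤ C' * h ^ n := by
  obtain ⟨K, hK, hK2⟩ := zygD_half n L hL
  have hC0 : 0 ≤ C := by
    have := (abs_nonneg _).trans (hC 1 one_pos 0); simpa using this
  have hB : ∀ h : ℝ, 0 < h → ∀ x, |zygD L w h φ x - φ1 x| ≤ 2 * (K * C) * h ^ n := by
    intro h hh x
    have := dist_le_of_le_geometric_two_of_tendsto₀ (f := fun k : ℕ => zygD L w (h / 2 ^ k) φ x)
      (a := φ1 x)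
      (zyg_tele n hn (K * C) h (by positivity) hh (fun h => zygD L w h φ x)
        (fun h hh => hK2 M φ w C hC h hh x)) (zygD_tendsto L h1 h2 w φ x _ (hd x) h hh)
    simpa [Real.dist_eq] using this
  refine ⟨⟨_, hB⟩, ?_⟩
  obtain ⟨r, hr⟩ := h1
  refine ⟨(r.sum fun _ a => |a|) * C2 + 2 ^ (n + 1) * (2 * (K * C)), fun h hh x => ?_⟩
  have hs : φ1 = zygD L w h φ + (fun x => φ1 x - zygD L w h φ x) := by ext x; simp
  have e1 : (fwdDiff (h • u))^[n + 1] (zygD L w h φ) x =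
      h⁻¹ * zygAct M (Polynomial.aeval (zygE (h • w)) r)
        (fwdDiff (h • w) ((fwdDiff (h • u))^[n + 1] φ)) x := by
    have f1 : zygD L w h φ = h⁻¹ • zygAct M (Polynomial.aeval (zygE (h • w)) L) φ := by
      ext y; simp [zygD]; ring
    have f2 : fwdDiff (h • w) ((fwdDiff (h • u))^[n + 1] φ) =
      zygAct M ((zygE (h • w) - 1) ^ 1) (zygAct M ((zygE (h • u) - 1) ^ (n + 1)) φ) := by
      rw [zygAct_diff, zygAct_diff]; rfl
    rw [f1, ← zygAct_diff, map_smul, f2, Pi.smul_apply, smul_eq_mul,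
      ← Module.End.mul_apply, ← Module.End.mul_apply, ← Module.End.mul_apply,
      ← map_mul, ← map_mul, ← map_mul, hr]
    have : Polynomial.aeval (zygE (h • w)) ((Polynomial.X - 1) * r) =
        (zygE (h • w) - 1) * Polynomial.aeval (zygE (h • w)) r := by
      rw [map_mul, map_sub, Polynomial.aeval_X, map_one]
    rw [this]
    congr 4
    ring
  have e2 : |(fwdDiff (h • u))^[n + 1] (zygD L w h φ) x| ≤ (r.sum fun _ a => |a|) * C2 * h ^ n := by
    rw [e1, abs_mul, abs_of_pos (inv_pos.2 hh), inv_mul_le_iff₀ hh]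
    refine (zygAct_bound _ r _ _ (hC2 h hh) x).trans (le_of_eq ?_)
    ring
  have e3 := zyg_fwdDiff_bound (h • u) (n + 1) (fun x => φ1 x - zygD L w h φ x) _
    (fun x => by rw [abs_sub_comm]; exact hB h hh x) x
  rw [hs, fwdDiff_iter_add, Pi.add_apply]
  refine (abs_add_le _ _).trans ?_
  linarith

lemma zygD_continuous (L : Polynomial ℝ) (h : ℝ) (φ : ℝ → ℝ) (hφ : Continuous φ) :
    Continuous (zygD L (1:ℝ) h φ) := by
  unfold zygD
  simp only [zygAct_poly, Polynomial.sum]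
  fun_prop

lemma zyg_one_dim (n : ℕ) (hn : 1 ≤ n) (φ : ℝ → ℝ) (hφ : Continuous φ) (C : ℝ)
    (hC : ∀ h : ℝ, 0 < h → ∀ x, |(fwdDiff h)^[n + 2] φ x| ≤ C * h ^ (n + 1)) :
    ∃ φ1 : ℝ → ℝ, Continuous φ1 ∧ (∀ x, HasDerivAt φ (φ1 x) x) ∧
    ∃ C' : ℝ, ∀ h : ℝ, 0 < h → ∀ x, |(fwdDiff h)^[n + 1] φ1 x| ≤ C' * h ^ n := by
  obtain ⟨L, h1, h2, hL⟩ := zyg_exists_poly n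
  obtain ⟨K, hK, hK2⟩ := zygD_half n L hL
  have hC0 : 0 ≤ C := by
    have := (abs_nonneg _).trans (hC 1 one_pos 0); simpa using this
  have hC' : ∀ h : ℝ, 0 < h → ∀ x, |(fwdDiff (h • (1:ℝ)))^[n + 2] φ x| ≤ C * h ^ (n + 1) := by
    simpa using hC
  have tele := fun x => zyg_tele n hn (K * C) 1 (by positivity) one_pos (fun h => zygD L (1:ℝ) h φ x)
        (fun h hh => hK2 ℝ φ 1 C hC' h hh x)
  have hlim : ∀ x, ∃ y, Filter.Tendsto (fun k : ℕ => zygD L (1:ℝ) (1 / 2 ^ k) φ x) Filter.atTop (nhds y) :=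
    fun x => cauchySeq_tendsto_of_complete (cauchySeq_of_le_geometric_two (tele x))
  choose φ1 hφ1 using hlim
  have hunif : TendstoUniformly (fun k : ℕ => zygD L (1:ℝ) (1 / 2 ^ k) φ) φ1 Filter.atTop := by
    rw [Metric.tendstoUniformly_iff]
    intro ε hε
    have : Filter.Tendsto (fun k : ℕ => (2 * (K * C) * 1 ^ n) / 2 ^ k) Filter.atTop (nhds 0) := by
      have := (tendsto_pow_atTop_nhds_zero_of_lt_one (r := (1/2:ℝ)) (by norm_num) (by norm_num)).const_mul (2 * (K * C) * 1 ^ n)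
      simpa [div_eq_mul_inv] using this
    filter_upwards [this.eventually_lt_const hε] with k hk x
    rw [dist_comm]
    exact (dist_le_of_le_geometric_two_of_tendsto (tele x) (hφ1 x) k).trans_lt hk
  have hcont : Continuous φ1 :=
    hunif.continuous (Filter.Eventually.of_forall fun k => zygD_continuous L _ φ hφ).frequently
  set G : ℝ → ℝ := fun x => ∫ t in (0:ℝ)..x, φ t with hG
  have hGd : ∀ x, HasDerivAt G (φ x) x := fun x => hφ.integral_hasStrictDerivAt 0 x |>.hasDerivAt
  have hder : ∀ x, HasDerivAt φ (φ1 x) x := by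
    refine hasDerivAt_of_tendstoUniformly hunif (f := fun k : ℕ => zygD L (1:ℝ) (1 / 2 ^ k) G)
      (Filter.Eventually.of_forall fun k x => ?_) (fun x => ?_)
    · unfold zygD
      simp only [zygAct_poly, Polynomial.sum]
      refine HasDerivAt.div_const (HasDerivAt.fun_sum fun i _ => HasDerivAt.const_mul _ ?_) _
      exact (hGd _).comp_add_const _ _
    · refine zygD_tendsto L h1 h2 1 G x (φ x) ?_ 1 one_pos
      have : HasDerivAt G (φ x) (x + 0) := by simpa using hGd x
      simpa using this.comp_const_add x 0
  refine ⟨φ1, hcont, hder, ?_⟩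
  have := (zyg_transfer n hn L h1 h2 hL ℝ φ φ1 1 1 C C hC' (fun x => ?_) (fun h hh x => ?_)).2
  · simpa using this
  · have : HasDerivAt φ (φ1 x) (x + 0) := by simpa using hder x
    simpa using this.comp_const_add x 0
  · have := hC' h hh x
    rwa [Function.iterate_succ_apply'] at this

lemma zyg_iter (n : ℕ) : ∀ (φ : ℝ → ℝ), Continuous φ → ∀ C : ℝ,
    (∀ h : ℝ, 0 < h → ∀ x, |(fwdDiff h)^[n + 2] φ x| ≤ C * h ^ (n + 1)) →
    ContDiff ℝ n φ ∧ ∃ C' : ℝ, ∀ h : ℝ, 0 < h → ∀ x,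
      |(fwdDiff h)^[2] (iteratedDeriv n φ) x| ≤ C' * h := by
  induction n with
  | zero =>
    intro φ hφ C hC
    refine ⟨by simpa [contDiff_zero] using hφ, C, by simpa using hC⟩
  | succ n ih =>
    intro φ hφ C hC
    obtain ⟨φ1, hc, hd, C', hC'⟩ := zyg_one_dim (n + 1) (by omega) φ hφ C hC
    have hd1 : deriv φ = φ1 := funext fun x => (hd x).deriv
    obtain ⟨i1, i2⟩ := ih φ1 hc C' hC'
    refine ⟨?_, ?_⟩
    · push_cast
      rw [contDiff_succ_iff_deriv]
      refine ⟨fun x => (hd x).differentiableAt, by simp, by rw [hd1]; exact i1⟩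
    · rw [iteratedDeriv_succ', hd1]; exact i2


lemma zyg_bound_deriv (b : ℝ → ℝ) (hb : ContDiff ℝ (⊤ : ℕ∞) b) (hc : HasCompactSupport b) (k : ℕ) :
    ∃ B : ℝ, ∀ x, |iteratedDeriv k b x| ≤ B := by
  obtain ⟨B, hB⟩ := (hc.iteratedFDeriv (𝕜 := ℝ) k).exists_bound_of_continuous
    (hb.continuous_iteratedFDeriv (by exact_mod_cast le_top))
  exact ⟨B, fun x => by rw [← Real.norm_eq_abs, ← norm_iteratedFDeriv_eq_norm_iteratedDeriv]; exact hB x⟩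

lemma zyg_glue (p q : ℕ → ℝ) (hp : ∀ n, |p n| ≤ 1 / (n.factorial : ℝ))
    (hq : ∀ n, |q n| ≤ 1 / (n.factorial : ℝ)) :
    ∃ c : ℝ → ℝ, ContDiff ℝ (⊤ : ℕ∞) c ∧ ∀ n : ℕ, ∀ s : ℝ, 0 ≤ s → s ≤ 1 →
      c ((4 + s) / 2 ^ n) = p n + q n * s := by
  let β : ContDiffBump (9/2 : ℝ) := ⟨1/2, 3/2, by norm_num, by norm_num⟩
  have hβ1 : ∀ s : ℝ, 4 ≤ s → s ≤ 5 → β s = 1 := by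
    intro s h1 h2
    apply β.one_of_mem_closedBall
    rw [Metric.mem_closedBall, Real.dist_eq, abs_le]
    show -(1/2:ℝ) ≤ _ ∧ _ ≤ (1/2:ℝ)
    constructor <;> linarith
  have hβ0 : ∀ s : ℝ, (s ≤ 3 ∨ 6 ≤ s) → β s = 0 := by
    intro s h
    apply β.zero_of_le_dist
    rw [Real.dist_eq]
    show (3/2:ℝ) ≤ _
    rcases h with h | h
    · rw [abs_of_nonpos (by linarith)]; linarith
    · rw [abs_of_nonneg (by linarith)]; linarith
  have hb : ContDiff ℝ (⊤ : ℕ∞) (β : ℝ → ℝ) := β.contDiff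
  have hg : ContDiff ℝ (⊤ : ℕ∞) (fun s : ℝ => (s - 4) * β s) :=
    (contDiff_id.sub contDiff_const).mul hb
  have hbc : HasCompactSupport (β : ℝ → ℝ) := β.hasCompactSupport
  have hgc : HasCompactSupport (fun s : ℝ => (s - 4) * β s) := hbc.mul_left
  choose B1 hB1 using zyg_bound_deriv _ hb hbc
  choose B2 hB2 using zyg_bound_deriv _ hg hgc
  let u : ℕ → ℝ → ℝ := fun n t => p n * β (2 ^ n * t) + q n * ((2 ^ n * t - 4) * β (2 ^ n * t))
  have hterm1 : ∀ (b : ℝ → ℝ), ContDiff ℝ (⊤ : ℕ∞) b → ∀ (a r : ℝ),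
      ContDiff ℝ (⊤ : ℕ∞) (fun t => a * b (r * t)) := fun b hb a r =>
    contDiff_const.mul (hb.comp (contDiff_const.mul contDiff_id))
  have hcast : ∀ k : ℕ, (k : WithTop ℕ∞) ≤ ((⊤ : ℕ∞) : WithTop ℕ∞) := fun k => by exact_mod_cast le_top
  have hiter : ∀ (b : ℝ → ℝ), ContDiff ℝ (⊤ : ℕ∞) b → ∀ (a r : ℝ) (k : ℕ) (t : ℝ),
      iteratedDeriv k (fun t => a * b (r * t)) t = a * (r ^ k * iteratedDeriv k b (r * t)) := by
    intro b hb a r k t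
    rw [iteratedDeriv_const_mul_field a (fun t => b (r * t)),
      iteratedDeriv_comp_const_mul (hb.of_le (hcast k))]
  refine ⟨fun t => ∑' n, u n t, ?_, ?_⟩
  · refine contDiff_tsum (v := fun k n => (B1 k + B2 k) * ((2 ^ k) ^ n / (n.factorial : ℝ))) ?_ ?_ ?_
    · intro n
      exact (hterm1 _ hb _ _).add (hterm1 _ hg (q n) (2 ^ n))
    · intro k _
      exact (Real.summable_pow_div_factorial _).mul_left _
    · intro k n t _
      rw [norm_iteratedFDeriv_eq_norm_iteratedDeriv]
      have e : iteratedDeriv k (u n) t = p n * ((2 ^ n) ^ k * iteratedDeriv k β (2 ^ n * t)) +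
          q n * ((2 ^ n) ^ k * iteratedDeriv k (fun s : ℝ => (s - 4) * β s) (2 ^ n * t)) := by
        rw [← hiter _ hb, ← hiter _ hg]
        exact iteratedDeriv_add (((hterm1 _ hb _ _).of_le (hcast k)).contDiffAt)
          (((hterm1 _ hg _ _).of_le (hcast k)).contDiffAt)
      rw [e]
      refine (norm_add_le _ _).trans ?_
      simp only [norm_mul, Real.norm_eq_abs, abs_of_pos (show (0:ℝ) < (2 ^ n) ^ k by positivity)]
      have e2 : (B1 k + B2 k) * ((2 ^ k) ^ n / (n.factorial : ℝ)) =
        1 / (n.factorial : ℝ) * ((2 ^ n) ^ k * B1 k) + 1 / (n.factorial : ℝ) * ((2 ^ n) ^ k * B2 k) := by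
        rw [← pow_mul, ← pow_mul, mul_comm k n]; ring
      rw [e2]
      gcongr
      · exact hp n
      · exact hB1 k _
      · exact hq n
      · exact hB2 k _
  · intro n s hs0 hs1
    show ∑' k, u k _ = _
    rw [tsum_eq_single n]
    · have : (2:ℝ) ^ n * ((4 + s) / 2 ^ n) = 4 + s := by field_simp
      simp only [u, this, hβ1 (4 + s) (by linarith) (by linarith)]
      ring
    · intro k hk
      have : β (2 ^ k * ((4 + s) / 2 ^ n)) = 0 := by
        apply hβ0
        rcases lt_or_gt_of_ne hk with h | h
        · left
          have h2 : (2:ℝ) ^ (k + 1) ≤ 2 ^ n := pow_le_pow_right₀ (by norm_num) h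
          rw [pow_succ] at h2
          rw [← mul_div_assoc, div_le_iff₀ (by positivity)]
          have : (0:ℝ) < 2 ^ k := by positivity
          nlinarith
        · right
          have h2 : (2:ℝ) ^ (n + 1) ≤ 2 ^ k := pow_le_pow_right₀ (by norm_num) h
          rw [pow_succ] at h2
          rw [← mul_div_assoc, le_div_iff₀ (by positivity)]
          have : (0:ℝ) < 2 ^ n := by positivity
          nlinarith
      simp [u, this]

/-- difference bound for `C^m` functions -/
lemma zyg_diff_le (m : ℕ) : ∀ (ψ : ℝ → ℝ), ContDiff ℝ m ψ → ∀ (x h B : ℝ), 0 ≤ h →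
    (∀ y, x ≤ y → y ≤ x + m * h → |iteratedDeriv m ψ y| ≤ B) →
    |(fwdDiff h)^[m] ψ x| ≤ B * h ^ m := by
  induction m with
  | zero => intro ψ _ x h B hh hB; simpa using hB x le_rfl (by simp)
  | succ m ih =>
    intro ψ hψ x h B hh hB
    have hψm : ContDiff ℝ m ψ := hψ.of_le (by norm_cast; omega)
    have hsh : ContDiff ℝ m (fun z => ψ (z + h)) := hψm.comp (contDiff_id.add contDiff_const)
    have hfd : ContDiff ℝ m (fwdDiff h ψ) := hsh.sub hψm
    rw [Function.iterate_succ_apply]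
    refine (ih (fwdDiff h ψ) hfd x h (B * h) hh ?_).trans (le_of_eq (by ring))
    intro y hy1 hy2
    have e : iteratedDeriv m (fwdDiff h ψ) y = iteratedDeriv m ψ (y + h) - iteratedDeriv m ψ y := by
      have := iteratedDeriv_sub (n := m) (x := y) hsh.contDiffAt hψm.contDiffAt
      rw [iteratedDeriv_comp_add_const] at this
      exact this
    rw [e]
    have hdiff : Differentiable ℝ (iteratedDeriv m ψ) :=
      hψ.differentiable_iteratedDeriv m (by norm_cast; omega)
    have := Convex.norm_image_sub_le_of_norm_deriv_le (𝕜 := ℝ) (f := iteratedDeriv m ψ) (C := B)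
      (s := Set.Icc y (y + h)) (x := y) (y := y + h) (fun z _ => hdiff z) (fun z hz => ?_) (convex_Icc _ _)
      ⟨le_rfl, by linarith⟩ ⟨by linarith, le_rfl⟩
    · simpa [abs_of_nonneg hh] using this
    · rw [← iteratedDeriv_succ]
      refine hB z (by linarith [hz.1]) ?_
      push_cast; linarith [hz.2]

lemma zyg_curve_bound (m : ℕ) (φ : ℝ → ℝ) (hφ : ZygmundClassR m φ) :
    ∃ C : ℝ, 0 ≤ C ∧ ∀ x τ : ℝ, 0 ≤ x → 0 < τ → x + (m + 2) * τ ≤ 5 →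
      |(fwdDiff τ)^[m + 2] φ x| ≤ C * τ ^ (m + 1) := by
  obtain ⟨hc, hK⟩ := hφ
  obtain ⟨C, hC⟩ := hK (Set.Icc 0 5) isCompact_Icc
  refine ⟨max C 0, le_max_right _ _, fun x τ hx hτ hxτ => ?_⟩
  rw [Function.iterate_add_apply]
  have h1 : ContDiff ℝ m (fun z => φ (z + τ)) := hc.comp (contDiff_id.add contDiff_const)
  have hd1 : ContDiff ℝ m (fwdDiff τ φ) := h1.sub hc
  have h2 : ContDiff ℝ m (fun z => fwdDiff τ φ (z + τ)) := hd1.comp (contDiff_id.add contDiff_const)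
  have hd2 : ContDiff ℝ m ((fwdDiff τ)^[2] φ) := h2.sub hd1
  have e1 : ∀ y, iteratedDeriv m (fwdDiff τ φ) y = iteratedDeriv m φ (y + τ) - iteratedDeriv m φ y := by
    intro y
    have := iteratedDeriv_sub (n := m) (x := y) h1.contDiffAt hc.contDiffAt
    rw [iteratedDeriv_comp_add_const] at this
    exact this
  have e2 : ∀ y, iteratedDeriv m ((fwdDiff τ)^[2] φ) y =
      iteratedDeriv m (fwdDiff τ φ) (y + τ) - iteratedDeriv m (fwdDiff τ φ) y := by
    intro y
    have := iteratedDeriv_sub (n := m) (x := y) h2.contDiffAt hd1.contDiffAt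
    rw [iteratedDeriv_comp_add_const] at this
    exact this
  refine (zyg_diff_le m _ hd2 x τ (max C 0 * τ) hτ.le ?_).trans (le_of_eq (by ring))
  intro y hy1 hy2
  have := hC (y + τ) τ ⟨by linarith, by linarith⟩ ⟨by linarith, by linarith⟩
    ⟨by linarith, by linarith⟩ hτ.ne'
  rw [abs_of_pos hτ] at this
  rw [e2, e1, e1]
  have h3 : C * τ ≤ max C 0 * τ := by gcongr; exact le_max_left _ _
  refine le_trans (le_of_eq ?_) (this.trans h3)
  congr 1
  rw [add_sub_cancel_right]; ring

/-- The hypothesis of the theorem. -/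
def ZygHyp (m : ℕ) (f : ℝ × ℝ → ℝ) : Prop :=
  ∀ c : ℝ → ℝ × ℝ, ContDiff ℝ (⊤ : ℕ∞) c → ZygmundClassR m (f ∘ c)

lemma zyg_glue2 (a : ℝ × ℝ) (b w : ℕ → ℝ × ℝ) (hb : ∀ n, ‖b n - a‖ ≤ 1 / (n.factorial : ℝ))
    (hw : ∀ n, ‖w n‖ ≤ 1 / (n.factorial : ℝ)) :
    ∃ c : ℝ → ℝ × ℝ, ContDiff ℝ (⊤ : ℕ∞) c ∧ ∀ n : ℕ, ∀ s : ℝ, 0 ≤ s → s ≤ 1 →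
      c ((4 + s) / 2 ^ n) = b n + s • w n := by
  obtain ⟨c1, h1, h1'⟩ := zyg_glue (fun n => (b n - a).1) (fun n => (w n).1)
    (fun n => (norm_fst_le (b n - a)).trans (hb n)) (fun n => (norm_fst_le (w n)).trans (hw n))
  obtain ⟨c2, h2, h2'⟩ := zyg_glue (fun n => (b n - a).2) (fun n => (w n).2)
    (fun n => (norm_snd_le (b n - a)).trans (hb n)) (fun n => (norm_snd_le (w n)).trans (hw n))
  refine ⟨fun t => (a.1 + c1 t, a.2 + c2 t), (contDiff_const.add h1).prodMk (contDiff_const.add h2), ?_⟩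
  intro n s hs0 hs1
  ext
  · simp [h1' n s hs0 hs1]; ring
  · simp [h2' n s hs0 hs1]; ring

lemma zyg_local_bdd (m : ℕ) (f : ℝ × ℝ → ℝ) (hf : ZygHyp m f) (a : ℝ × ℝ) :
    ∃ C δ : ℝ, 0 < δ ∧ ∀ b, ‖b - a‖ < δ → |f b| ≤ C := by
  by_contra! hcon
  choose b hb1 hb2 using fun n : ℕ => hcon n (1 / (n.factorial : ℝ)) (by positivity)
  obtain ⟨c, hc, hc2⟩ := zyg_glue2 a b (fun _ => 0) (fun n => (hb1 n).le) (fun n => by simp)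
  have hcont : Continuous (f ∘ c) := (hf c hc).1.continuous
  obtain ⟨C, hC⟩ := (isCompact_Icc (a := (0:ℝ)) (b := 5)).exists_bound_of_continuousOn hcont.continuousOn
  obtain ⟨n, hn⟩ := exists_nat_gt C
  have h1 := hC ((4 + 0) / 2 ^ n) ⟨by positivity, by
    rw [div_le_iff₀ (by positivity)]
    have : (1:ℝ) ≤ 2 ^ n := one_le_pow₀ (by norm_num)
    linarith⟩
  rw [Function.comp_apply, hc2 n 0 le_rfl zero_le_one] at h1
  simp at h1
  linarith [hb2 n]

lemma zyg_local_diff (m : ℕ) (f : ℝ × ℝ → ℝ) (hf : ZygHyp m f) (a : ℝ × ℝ) :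
    ∃ C δ : ℝ, 0 < δ ∧ ∀ b, ‖b - a‖ < δ → ∀ v, ‖v‖ < δ →
      |(fwdDiff v)^[m + 2] f b| ≤ C * ‖v‖ ^ (m + 1) := by
  by_contra! hcon
  choose b hb1 v hv1 hv2 using fun n : ℕ => hcon (n * (n.factorial : ℝ) ^ (m + 1))
    (1 / ((n.factorial : ℝ) * (m + 2))) (by positivity)
  have hv0 : ∀ n, 0 < ‖v n‖ := by
    intro n
    rw [norm_pos_iff]
    intro h0
    have := hv2 n
    rw [h0, Function.iterate_succ_apply'] at this
    simp [fwdDiff] at this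
  have hfac : ∀ n : ℕ, (0:ℝ) < n.factorial := fun n => by positivity
  obtain ⟨c, hc, hc2⟩ := zyg_glue2 a b (fun n => (‖v n‖ * n.factorial)⁻¹ • v n) (fun n => by
      refine (hb1 n).le.trans ?_
      apply one_div_le_one_div_of_le (hfac n)
      have := hfac n
      have : (0:ℝ) ≤ m := by positivity
      nlinarith [hfac n]) (fun n => by
      rw [norm_smul, norm_inv, Real.norm_eq_abs, abs_of_pos (mul_pos (hv0 n) (hfac n))]
      have := hv0 n
      have := hfac n
      apply le_of_eq; field_simp)
  obtain ⟨C, hC0, hC⟩ := zyg_curve_bound m _ (hf c hc)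
  obtain ⟨n, hn⟩ := exists_nat_gt C
  have hs : (m + 2) * (‖v n‖ * n.factorial) ≤ 1 := by
    have := (hv1 n).le
    rw [le_div_iff₀ (by positivity)] at this
    linarith
  have hσ : 0 < ‖v n‖ * n.factorial := mul_pos (hv0 n) (hfac n)
  have h2n : (1:ℝ) ≤ 2 ^ n := one_le_pow₀ (by norm_num)
  have h1 := hC (4 / 2 ^ n) (‖v n‖ * n.factorial / 2 ^ n) (by positivity) (by positivity) (by
    rw [← mul_div_assoc, ← add_div, div_le_iff₀ (by positivity)]
    linarith)
  have e : (fwdDiff (‖v n‖ * n.factorial / 2 ^ n))^[m + 2] (f ∘ c) (4 / 2 ^ n) =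
      (fwdDiff (v n))^[m + 2] f (b n) := by
    rw [fwdDiff_iter_eq_sum_shift, fwdDiff_iter_eq_sum_shift]
    refine Finset.sum_congr rfl fun i hi => ?_
    congr 1
    have hi' : (i:ℝ) ≤ m + 2 := by
      simp at hi; exact_mod_cast (by omega : i ≤ m + 2)
    have e1 : (4:ℝ) / 2 ^ n + i • (‖v n‖ * n.factorial / 2 ^ n) =
        (4 + i * (‖v n‖ * n.factorial)) / 2 ^ n := by
      rw [nsmul_eq_mul]; ring
    rw [Function.comp_apply, e1, hc2 n _ (by positivity) ?_, smul_smul, mul_assoc,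
      mul_inv_cancel₀ hσ.ne', mul_one, Nat.cast_smul_eq_nsmul]
    exact le_trans (by gcongr) hs
  rw [e] at h1
  have h3 := hv2 n
  have h4 : C * (‖v n‖ * n.factorial / 2 ^ n) ^ (m + 1) ≤
      n * (n.factorial : ℝ) ^ (m + 1) * ‖v n‖ ^ (m + 1) := by
    have : (‖v n‖ * n.factorial / 2 ^ n) ^ (m + 1) ≤ (‖v n‖ * n.factorial) ^ (m + 1) := by
      gcongr; exact div_le_self hσ.le h2n
    calc _ ≤ n * (‖v n‖ * n.factorial) ^ (m + 1) := by gcongr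
      _ = _ := by rw [mul_pow]; ring
  linarith

lemma zyg_cpt_bdd (m : ℕ) (f : ℝ × ℝ → ℝ) (hf : ZygHyp m f) (S : Set (ℝ × ℝ)) (hS : IsCompact S) :
    ∃ C : ℝ, ∀ b ∈ S, |f b| ≤ C := by
  refine hS.induction_on (p := fun S => ∃ C : ℝ, ∀ b ∈ S, |f b| ≤ C) ⟨0, by simp⟩ ?_ ?_ ?_
  · rintro s t hst ⟨C, hC⟩; exact ⟨C, fun b hb => hC b (hst hb)⟩
  · rintro s t ⟨C, hC⟩ ⟨C', hC'⟩
    refine ⟨max C C', fun b hb => ?_⟩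
    rcases hb with hb | hb
    · exact (hC b hb).trans (le_max_left _ _)
    · exact (hC' b hb).trans (le_max_right _ _)
  · intro a _
    obtain ⟨C, δ, hδ, h⟩ := zyg_local_bdd m f hf a
    refine ⟨Metric.ball a δ, mem_nhdsWithin_of_mem_nhds (Metric.ball_mem_nhds a hδ), C, fun b hb => h b ?_⟩
    rwa [Metric.mem_ball, dist_eq_norm] at hb

lemma zyg_cpt_diff (m : ℕ) (f : ℝ × ℝ → ℝ) (hf : ZygHyp m f) (S : Set (ℝ × ℝ)) (hS : IsCompact S) :
    ∃ C δ : ℝ, 0 < δ ∧ ∀ b ∈ S, ∀ v, ‖v‖ < δ →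
      |(fwdDiff v)^[m + 2] f b| ≤ C * ‖v‖ ^ (m + 1) := by
  refine hS.induction_on (p := fun S => ∃ C δ : ℝ, 0 < δ ∧ ∀ b ∈ S, ∀ v, ‖v‖ < δ →
      |(fwdDiff v)^[m + 2] f b| ≤ C * ‖v‖ ^ (m + 1)) ⟨0, 1, one_pos, by simp⟩ ?_ ?_ ?_
  · rintro s t hst ⟨C, δ, hδ, hC⟩; exact ⟨C, δ, hδ, fun b hb => hC b (hst hb)⟩
  · rintro s t ⟨C, δ, hδ, hC⟩ ⟨C', δ', hδ', hC'⟩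
    refine ⟨max C C', min δ δ', lt_min hδ hδ', fun b hb v hv => ?_⟩
    rcases hb with hb | hb
    · refine (hC b hb v (hv.trans_le (min_le_left _ _))).trans ?_
      gcongr; exact le_max_left _ _
    · refine (hC' b hb v (hv.trans_le (min_le_right _ _))).trans ?_
      gcongr; exact le_max_right _ _
  · intro a _
    obtain ⟨C, δ, hδ, h⟩ := zyg_local_diff m f hf a
    refine ⟨Metric.ball a δ, mem_nhdsWithin_of_mem_nhds (Metric.ball_mem_nhds a hδ), C, δ, hδ,
      fun b hb => h b ?_⟩
    rwa [Metric.mem_ball, dist_eq_norm] at hb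

lemma zyg_global_diff (m : ℕ) (F : ℝ × ℝ → ℝ) (hF : ZygHyp m F) (S : Set (ℝ × ℝ)) (hS : IsCompact S)
    (hcomp : ∀ b, ∃ b' ∈ S, ∀ v : ℝ × ℝ, ‖v‖ ≤ m + 2 → F (b' + v) = F (b + v)) :
    ∃ C : ℝ, 0 ≤ C ∧ ∀ b v, |(fwdDiff v)^[m + 2] F b| ≤ C * ‖v‖ ^ (m + 1) := by
  obtain ⟨B, hB⟩ := zyg_cpt_bdd m F hF S hS
  have hB' : ∀ b, |F b| ≤ B := by
    intro b
    obtain ⟨b', hb', h⟩ := hcomp b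
    have := h 0 (by simp; positivity)
    simp at this
    rw [← this]; exact hB b' hb'
  have hB0 : 0 ≤ B := (abs_nonneg _).trans (hB' 0)
  obtain ⟨C, δ, hδ, hC⟩ := zyg_cpt_diff m F hF S hS
  set d := min δ 1 with hd
  have hd0 : 0 < d := lt_min hδ one_pos
  refine ⟨max C (2 ^ (m + 2) * B / d ^ (m + 1)), le_max_of_le_right (by positivity), fun b v => ?_⟩
  rcases lt_or_ge ‖v‖ d with hv | hv
  · obtain ⟨b', hb', h⟩ := hcomp b
    have e : (fwdDiff v)^[m + 2] F b = (fwdDiff v)^[m + 2] F b' := by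
      rw [fwdDiff_iter_eq_sum_shift, fwdDiff_iter_eq_sum_shift]
      refine Finset.sum_congr rfl fun i hi => ?_
      congr 1
      refine (h _ ?_).symm
      have hi' : (i:ℝ) ≤ m + 2 := by
        simp at hi; exact_mod_cast (by omega : i ≤ m + 2)
      rw [← Nat.cast_smul_eq_nsmul ℝ, norm_smul, Real.norm_natCast]
      calc (i:ℝ) * ‖v‖ ≤ (m + 2) * 1 := by
            gcongr; exact hv.le.trans (min_le_right _ _)
        _ = _ := by ring
    rw [e]
    refine (hC b' hb' v (hv.trans_le (min_le_left _ _))).trans ?_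
    gcongr; exact le_max_left _ _
  · refine (zyg_fwdDiff_bound v (m + 2) F B hB' b).trans ?_
    calc 2 ^ (m + 2) * B = 2 ^ (m + 2) * B / d ^ (m + 1) * d ^ (m + 1) := by field_simp
      _ ≤ max C (2 ^ (m + 2) * B / d ^ (m + 1)) * ‖v‖ ^ (m + 1) := by
        gcongr; exact le_max_right _ _

lemma zyg_mixed (m : ℕ) (F : ℝ × ℝ → ℝ) (C : ℝ) (hC0 : 0 ≤ C)
    (hC : ∀ b v, |(fwdDiff v)^[m + 2] F b| ≤ C * ‖v‖ ^ (m + 1)) :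
    ∃ C2 : ℝ, ∀ h : ℝ, 0 < h → ∀ x, |fwdDiff (h • ((0:ℝ), (1:ℝ)))
      ((fwdDiff (h • ((1:ℝ), (0:ℝ))))^[m + 1] F) x| ≤ C2 * h ^ (m + 1) := by
  refine ⟨(Finset.range (m + 2)).powerset.card * (C * (m + 2) ^ (m + 1)), fun h hh x => ?_⟩
  set w : ℝ × ℝ := h • ((0:ℝ), (1:ℝ)) with hw
  set u : ℝ × ℝ := h • ((1:ℝ), (0:ℝ)) with hu
  let H : ℕ → ℝ × ℝ := fun j => if j = 0 then w else u
  have hwn : ‖w‖ = h := by simp [hw, Prod.norm_def, abs_of_pos hh, hh.le]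
  have hun : ‖u‖ = h := by simp [hu, Prod.norm_def, abs_of_pos hh, hh.le]
  have hH : ∀ j, ‖H j‖ = h := by
    intro j; simp only [H]; split_ifs <;> assumption
  have hp := zyg_polar (m + 2) H
  rw [Finset.prod_range_succ'] at hp
  have hp' : ∏ k ∈ Finset.range (m + 1), (zygE (H (k + 1)) - 1) = (zygE u - 1) ^ (m + 1) := by
    simp [H, -AddMonoidAlgebra.single_sub]
  rw [hp'] at hp
  have e : fwdDiff w ((fwdDiff u)^[m + 1] F) x =
      zygAct _ ((zygE u - 1) ^ (m + 1) * (zygE (H 0) - 1)) F x := by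
    rw [mul_comm, map_mul, Module.End.mul_apply, zygAct_diff]
    have := zygAct_diff w 1 ((fwdDiff u)^[m + 1] F)
    rw [pow_one] at this
    simp only [H, if_true]
    rw [this]; rfl
  rw [e, hp, map_sum, LinearMap.sum_apply, Finset.sum_apply]
  refine (Finset.abs_sum_le_sum_abs _ _).trans ?_
  refine (Finset.sum_le_card_nsmul _ _ (C * ((m + 2) * h) ^ (m + 1)) ?_).trans
    (le_of_eq ?_)
  · intro s hs
    have hn : ‖-∑ j ∈ s, ((j : ℝ) + 1)⁻¹ • H j‖ ≤ (m + 2) * h := by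
      rw [norm_neg]
      refine (norm_sum_le _ _).trans ?_
      have hc : s.card ≤ m + 2 := by
        simpa using Finset.card_le_card (Finset.mem_powerset.1 hs)
      refine (Finset.sum_le_card_nsmul _ _ h ?_).trans ?_
      · intro j _
        rw [norm_smul, hH, norm_inv, Real.norm_eq_abs, abs_of_pos (by positivity)]
        refine mul_le_of_le_one_left hh.le (inv_le_one_of_one_le₀ ?_)
        have : (0:ℝ) ≤ j := by positivity
        linarith
      · rw [nsmul_eq_mul]
        gcongr
        exact_mod_cast hc
    have hb : |zygAct _ (zygE (∑ j ∈ s, H j) *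
        (zygE (-∑ j ∈ s, ((j : ℝ) + 1)⁻¹ • H j) - 1) ^ (m + 2)) F x| ≤ C * ((m + 2) * h) ^ (m + 1) := by
      rw [map_mul, Module.End.mul_apply, zygAct_E, zygAct_diff]
      refine (hC _ _).trans ?_
      gcongr
    rcases neg_one_pow_eq_or (AddMonoidAlgebra ℝ (ℝ × ℝ)) s.card with h1 | h1
    · rw [h1, one_mul]; exact hb
    · rw [h1, neg_one_mul, map_neg, LinearMap.neg_apply, Pi.neg_apply, abs_neg]; exact hb
  · rw [nsmul_eq_mul, mul_pow]; ring


lemma zyg_cutoff (R : ℝ) (hR : 0 < R) : ∃ ρ : ℝ → ℝ, ContDiff ℝ (⊤ : ℕ∞) ρ ∧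
    (∀ x, |x| ≤ R → ρ x = x) ∧ (∀ x, R + 1 ≤ |x| → ρ x = 0) := by
  let χ : ContDiffBump (0 : ℝ) := ⟨R, R + 1, hR, by linarith⟩
  refine ⟨fun x => x * χ x, contDiff_id.mul χ.contDiff, fun x hx => ?_, fun x hx => ?_⟩
  · have : χ x = 1 := χ.one_of_mem_closedBall (by simpa [Real.dist_eq, Metric.mem_closedBall] using hx)
    simp [this]
  · have : χ x = 0 := χ.zero_of_le_dist (by simpa [Real.dist_eq] using hx)
    simp [this]

lemma zyg_clamp (R T : ℝ) (hR : 0 < R) (hT : 0 ≤ T) (ρ : ℝ → ℝ)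
    (h0 : ∀ x, R + 1 ≤ |x| → ρ x = 0) (x : ℝ) :
    ∃ x' ∈ Set.Icc (-(R + 1 + T)) (R + 1 + T), ∀ t, |t| ≤ T → ρ (x' + t) = ρ (x + t) := by
  by_cases hx : |x| ≤ R + 1 + T
  · exact ⟨x, abs_le.1 hx, fun t _ => rfl⟩
  · refine ⟨R + 1 + T, ⟨by linarith, le_rfl⟩, fun t ht => ?_⟩
    have ht' := abs_le.1 ht
    push Not at hx
    rw [h0, h0]
    · have := abs_sub_abs_le_abs_sub x (-t)
      rw [abs_neg, sub_neg_eq_add] at this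
      linarith
    · rw [le_abs]; left; linarith

lemma zyg_main (k : ℕ) (f : ℝ × ℝ → ℝ) (hf : ZygHyp (k + 1) f) (R : ℝ) (hR : 0 < R) :
    ∃ G : ℝ → ℝ, (∀ x, |x| < R → G x = deriv (fun s => f (x, s)) 0) ∧ ContDiff ℝ k G ∧
      ∃ C' : ℝ, ∀ h : ℝ, 0 < h → ∀ x, |(fwdDiff h)^[2] (iteratedDeriv k G) x| ≤ C' * h := by
  obtain ⟨ρ, hρ, hρ1, hρ0⟩ := zyg_cutoff R hR
  let F : ℝ × ℝ → ℝ := fun p => f (ρ p.1, ρ p.2)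
  have hF : ZygHyp (k + 1) F := by
    intro c hc
    exact hf (fun t => (ρ (c t).1, ρ (c t).2))
      ((hρ.comp (contDiff_fst.comp hc)).prodMk (hρ.comp (contDiff_snd.comp hc)))
  set T : ℝ := ((k + 1 : ℕ) : ℝ) + 2 with hT
  have hT0 : 0 ≤ T := by positivity
  obtain ⟨C, hC0, hC⟩ := zyg_global_diff (k + 1) F hF
    (Set.Icc (-(R + 1 + T)) (R + 1 + T) ×ˢ Set.Icc (-(R + 1 + T)) (R + 1 + T))
    (isCompact_Icc.prod isCompact_Icc) (by
      intro b
      obtain ⟨x, hx, hx'⟩ := zyg_clamp R T hR hT0 ρ hρ0 b.1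
      obtain ⟨y, hy, hy'⟩ := zyg_clamp R T hR hT0 ρ hρ0 b.2
      refine ⟨(x, y), ⟨hx, hy⟩, fun v hv => ?_⟩
      have e1 := hx' v.1 ((norm_fst_le v).trans hv)
      have e2 := hy' v.2 ((norm_snd_le v).trans hv)
      simp only [F, Prod.fst_add, Prod.snd_add, e1, e2])
  obtain ⟨C2, hC2⟩ := zyg_mixed (k + 1) F C hC0 hC
  obtain ⟨L, h1, h2, hL⟩ := zyg_exists_poly (k + 1)
  let φ1 : ℝ × ℝ → ℝ := fun p => deriv (fun s : ℝ => F (p + s • ((0:ℝ), (1:ℝ)))) 0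
  have hd : ∀ p, HasDerivAt (fun s : ℝ => F (p + s • ((0:ℝ), (1:ℝ)))) (φ1 p) 0 := by
    intro p
    have hc := (hF (fun s : ℝ => p + s • ((0:ℝ), (1:ℝ))) (by fun_prop)).1
    have := hc.differentiable (by simp) 0
    exact this.hasDerivAt
  have key := zyg_transfer (k + 1) (by omega) L h1 h2 hL (ℝ × ℝ) F φ1 (0, 1) (1, 0) C C2
    (fun h hh x => by
      have := hC x (h • ((0:ℝ), (1:ℝ)))
      rwa [show ‖h • ((0:ℝ), (1:ℝ))‖ = h by
        simp [Prod.norm_def, abs_of_pos hh, hh.le]] at this) hd hC2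
  obtain ⟨⟨B, hB⟩, C', hC'⟩ := key
  let G : ℝ → ℝ := fun x => φ1 (x, 0)
  have hFc : ∀ s : ℝ, ∀ a : ℝ, Continuous fun x : ℝ => F (x + a, s) := by
    intro s a
    exact (hF (fun x : ℝ => (x + a, s)) (by fun_prop)).1.continuous
  have hGc : Continuous G := by
    have hu : TendstoUniformly (fun (h : ℝ) (x : ℝ) => zygD L ((0:ℝ), (1:ℝ)) h F (x, 0)) G
        (nhdsWithin 0 (Set.Ioi 0)) := by
      rw [Metric.tendstoUniformly_iff]
      intro ε hε
      have ht : Filter.Tendsto (fun h : ℝ => B * h ^ (k + 1)) (nhdsWithin 0 (Set.Ioi 0)) (nhds 0) := by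
        have : Continuous fun h : ℝ => B * h ^ (k + 1) := by fun_prop
        have := this.tendsto 0
        simp at this
        exact this.mono_left nhdsWithin_le_nhds
      filter_upwards [ht.eventually (gt_mem_nhds hε), self_mem_nhdsWithin] with h hh hh' x
      rw [dist_comm, Real.dist_eq]
      exact (hB h hh' (x, 0)).trans_lt hh
    refine hu.continuous (Filter.Eventually.frequently (Filter.Eventually.of_forall fun h => ?_))
    simp only [zygD, zygAct_poly, Polynomial.sum]
    refine Continuous.div_const (continuous_finsetSum _ fun i _ => continuous_const.mul ?_) _
    have := hFc (i • h) 0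
    simpa using this
  have hGd : ∀ h : ℝ, 0 < h → ∀ x, |(fwdDiff h)^[k + 2] G x| ≤ C' * h ^ (k + 1) := by
    intro h hh x
    have := hC' h hh (x, 0)
    rw [fwdDiff_iter_eq_sum_shift] at this ⊢
    simpa [G] using this
  obtain ⟨r1, r2⟩ := zyg_iter k G hGc C' hGd
  refine ⟨G, fun x hx => ?_, r1, r2⟩
  apply Filter.EventuallyEq.deriv_eq
  have : ∀ᶠ s : ℝ in nhds 0, s ∈ Metric.ball (0:ℝ) R := Metric.ball_mem_nhds _ hR
  filter_upwards [this] with s hs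
  have hs' : |s| < R := by simpa [Real.dist_eq] using hs
  simp [F, hρ1 x hx.le, hρ1 s hs'.le]

/-- **Proposition 3.5 (key induction step).** If `m ≥ 1` and `f : ℝ² → ℝ` is such that
`f ∘ c ∈ Z^{m,1}(ℝ)` for every smooth curve `c : ℝ → ℝ²`, then the partial derivative
`∂₂ f(·,0)` exists and belongs to `Z^{m-1,1}(ℝ)`. -/
theorem zygmund_induction_step (m : ℕ) (hm : 1 ≤ m) (f : ℝ × ℝ → ℝ)
    (hf : ∀ c : ℝ → ℝ × ℝ, ContDiff ℝ (⊤ : ℕ∞) c → ZygmundClassR m (f ∘ c)) :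
    (∀ x : ℝ, DifferentiableAt ℝ (fun s => f (x, s)) 0) ∧
      ZygmundClassR (m - 1) (fun x => deriv (fun s => f (x, s)) 0) := by
  obtain ⟨k, rfl⟩ : ∃ k, m = k + 1 := ⟨m - 1, by omega⟩
  refine ⟨fun x => ?_, ?_⟩
  · exact (hf (fun s : ℝ => (x, s)) (by fun_prop)).1.differentiable (by simp) 0
  rw [Nat.add_sub_cancel]
  refine ⟨contDiff_iff_contDiffAt.2 fun x => ?_, fun K hK => ?_⟩
  · obtain ⟨G, hG, hc, -⟩ := zyg_main k f hf (|x| + 1) (by positivity)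
    refine hc.contDiffAt.congr_of_eventuallyEq ?_
    have : ∀ᶠ y in nhds x, |y| < |x| + 1 :=
      continuous_abs.continuousAt.eventually (gt_mem_nhds (by linarith))
    filter_upwards [this] with y hy
    exact (hG y hy).symm
  · obtain ⟨R, hR, hKR⟩ := hK.isBounded.exists_pos_norm_lt
    obtain ⟨G, hG, -, C', hC'⟩ := zyg_main k f hf R hR
    have hopen : IsOpen {x : ℝ | |x| < R} := isOpen_lt continuous_abs continuous_const
    have heq : Set.EqOn (fun x => deriv (fun s => f (x, s)) 0) G {x : ℝ | |x| < R} :=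
      fun x hx => (hG x hx).symm
    have heq' := heq.iteratedDeriv_of_isOpen hopen k
    refine ⟨C', fun x h hx h1 h2 hh => ?_⟩
    rw [heq' (hKR x hx), heq' (hKR _ h1), heq' (hKR _ h2)]
    have := hC' |h| (abs_pos.2 hh) (x - |h|)
    refine le_trans (le_of_eq ?_) this
    simp only [Function.iterate_succ, Function.iterate_zero, Function.comp, fwdDiff, id]
    rcases lt_or_gt_of_ne hh with hh | hh
    · rw [abs_of_neg hh]; congr 1
      rw [show x - -h + -h = x by ring, show x - -h = x + h by ring, show x + -h = x - h by ring]
      ring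
    · rw [abs_of_pos hh, sub_add_cancel]; congr 1
      ring
end

section
/- Let m ≥ 1 be an integer, U ⊆ ℝ^d open, and f : U → ℝ a function such that f ∘ c ∈ Z^{m,1}(ℝ) for every c ∈ C^∞(ℝ, U). Then the directional derivative d_v f(x) := (d/dt)|_{t=0} f(x + t v) exists for all (x,v) ∈ U × ℝ^d, and for every smooth curve (x,v) ∈ C^∞(ℝ, U × ℝ^d) the function t ↦ d_{v(t)} f(x(t)) belongs to Z^{m−1,1}(ℝ). -/
/-! ### One-dimensional lemmas -/

lemma zyg_second_diff_bound (g g1 g2 : ℝ → ℝ) (h1 : ∀ t, HasDerivAt g (g1 t) t)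
    (h2 : ∀ t, HasDerivAt g1 (g2 t) t) (R M : ℝ) (hM : ∀ t, |t| ≤ R → |g2 t| ≤ M)
    (x h : ℝ) (hx : |x| ≤ R) (hp : |x + h| ≤ R) (hq : |x - h| ≤ R) :
    |g (x + h) - 2 * g x + g (x - h)| ≤ 2 * M * h ^ 2 := by
  have hM0 : 0 ≤ M := (abs_nonneg _).trans (hM x hx)
  -- the derivative is Lipschitz
  have hin : ∀ s : ℝ, |s| ≤ |h| → |x + s| ≤ R := by
    intro s hs
    rw [abs_le] at *
    rcases abs_cases h with ⟨e, _⟩ | ⟨e, _⟩ <;> rw [e] at hs <;> constructor <;> linarith [hs.1, hs.2]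
  have hlip : ∀ s : ℝ, |s| ≤ |h| → |g1 (x + s) - g1 (x - s)| ≤ M * (2 * |h|) := by
    intro s hs
    have := Convex.norm_image_sub_le_of_norm_hasDerivWithin_le (f := g1) (f' := g2)
      (s := Metric.closedBall (0 : ℝ) R) (C := M) (x := x - s) (y := x + s)
      (fun y _ => (h2 y).hasDerivWithinAt)
      (fun y hy => by
        rw [mem_closedBall_zero_iff] at hy
        exact hM y hy) (convex_closedBall _ _)
      (by
        rw [mem_closedBall_zero_iff, Real.norm_eq_abs, sub_eq_add_neg]
        exact hin (-s) (by rwa [abs_neg]))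
      (by rw [mem_closedBall_zero_iff, Real.norm_eq_abs]; exact hin s hs)
    rw [Real.norm_eq_abs, Real.norm_eq_abs] at this
    refine this.trans ?_
    gcongr
    rw [show x + s - (x - s) = 2 * s by ring, abs_mul, abs_two]
    gcongr
  have hd : ∀ s : ℝ, HasDerivAt (fun s => g (x + s) + g (x - s)) (g1 (x + s) - g1 (x - s)) s := by
    intro s
    have a1 := (h1 (x + s)).comp_const_add x s
    have a2 := (h1 (x - s)).comp_const_sub x s
    have a3 := a1.fun_add a2
    rwa [← sub_eq_add_neg] at a3
  have := Convex.norm_image_sub_le_of_norm_hasDerivWithin_le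
      (f := fun s => g (x + s) + g (x - s)) (f' := fun s => g1 (x + s) - g1 (x - s))
      (s := Metric.closedBall (0 : ℝ) |h|) (C := M * (2 * |h|)) (x := 0) (y := h)
      (fun y _ => (hd y).hasDerivWithinAt)
      (fun y hy => by
        rw [mem_closedBall_zero_iff] at hy
        exact hlip y hy) (convex_closedBall _ _)
      (by simp) (by simp)
  simp only [Real.norm_eq_abs, add_zero, sub_zero] at this
  calc |g (x + h) - 2 * g x + g (x - h)| = |g (x + h) + g (x - h) - (g x + g x)| := by ring_nf
    _ ≤ _ := this
    _ = 2 * M * |h| ^ 2 := by ring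
    _ = _ := by rw [sq_abs]

lemma zyg_series (n : ℕ) (Φ : ℕ → ℕ → ℝ → ℝ)
    (hd : ∀ j k t, HasDerivAt (Φ j k) (Φ j (k + 1) t) t)
    (hb : ∀ (R : ℝ) (k : ℕ), ∃ C : ℝ, ∀ j t, |t| ≤ R →
      |Φ j k t| ≤ C * ((2 : ℝ) ^ j) ^ k / ((2 : ℝ) ^ j) ^ (n + 1)) :
    ZygmundClassR n (fun t => ∑' j, Φ j 0 t) := by
  have hgeo : ∀ C : ℝ, Summable (fun j : ℕ => C * (1 / 2 : ℝ) ^ j) := fun C =>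
    (summable_geometric_of_lt_one (by norm_num) (by norm_num)).mul_left C
  have hb' : ∀ (R : ℝ) (k : ℕ), k ≤ n → ∃ C : ℝ, 0 ≤ C ∧ ∀ j t, |t| ≤ R →
      |Φ j k t| ≤ C * (1 / 2 : ℝ) ^ j := by
    intro R k hk
    obtain ⟨C, hC⟩ := hb R k
    refine ⟨|C|, abs_nonneg _, fun j t ht => (hC j t ht).trans ?_⟩
    have h1 : (1 : ℝ) ≤ 2 ^ j := one_le_pow₀ (by norm_num)
    rw [one_div, inv_pow, ← div_eq_mul_inv, div_le_div_iff₀ (by positivity) (by positivity)]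
    have h2 : ((2 : ℝ) ^ j) ^ k * 2 ^ j ≤ ((2 : ℝ) ^ j) ^ (n + 1) := by
      rw [← pow_succ]
      exact pow_le_pow_right₀ h1 (by omega)
    calc C * ((2 : ℝ) ^ j) ^ k * 2 ^ j ≤ |C| * ((2 : ℝ) ^ j) ^ k * 2 ^ j := by
          gcongr; exact le_abs_self C
      _ = |C| * (((2 : ℝ) ^ j) ^ k * 2 ^ j) := by ring
      _ ≤ _ := by gcongr
  have hsum : ∀ k ≤ n, ∀ t, Summable (fun j => Φ j k t) := by
    intro k hk t
    obtain ⟨C, -, hC⟩ := hb' |t| k hk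
    exact Summable.of_norm_bounded (hgeo C) (fun j => hC j t le_rfl)
  have hderiv : ∀ k, k + 1 ≤ n → ∀ t,
      HasDerivAt (fun t => ∑' j, Φ j k t) (∑' j, Φ j (k + 1) t) t := by
    intro k hk t
    obtain ⟨C, -, hC⟩ := hb' (|t| + 1) (k + 1) hk
    refine hasDerivAt_tsum_of_isPreconnected (hgeo C) (t := Metric.ball (0 : ℝ) (|t| + 1))
      Metric.isOpen_ball (convex_ball _ _).isPreconnected (fun j y _ => hd j k y) ?_
      (y₀ := t) (by simp) (hsum k (by omega) t) (by simp)
    intro j y hy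
    rw [mem_ball_zero_iff, Real.norm_eq_abs] at hy
    exact hC j y hy.le
  have hcont : ∀ k ≤ n, Continuous (fun t => ∑' j, Φ j k t) := by
    intro k hk
    rw [continuous_iff_continuousAt]
    intro t
    obtain ⟨C, -, hC⟩ := hb' (|t| + 1) k hk
    refine (continuousOn_tsum (s := Metric.ball (0 : ℝ) (|t| + 1))
      (fun j y _ => (hd j k y).continuousAt.continuousWithinAt) (hgeo C) ?_).continuousAt
      (Metric.isOpen_ball.mem_nhds (by simp))
    intro j y hy
    rw [mem_ball_zero_iff, Real.norm_eq_abs] at hy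
    exact hC j y hy.le
  have hiter : ∀ k ≤ n, iteratedDeriv k (fun t => ∑' j, Φ j 0 t) = fun t => ∑' j, Φ j k t := by
    intro k
    induction k with
    | zero => intro _; simp
    | succ k ih =>
      intro hk
      rw [iteratedDeriv_succ, ih (by omega)]
      funext t
      exact (hderiv k hk t).deriv
  refine ⟨?_, ?_⟩
  · rw [contDiff_nat_iff_iteratedDeriv]
    refine ⟨fun k hk => ?_, fun k hk => ?_⟩
    · rw [hiter k hk]; exact hcont k hk
    · rw [hiter k hk.le]; exact fun t => (hderiv k hk t).differentiableAt
  · intro K hK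
    rw [hiter n le_rfl]
    obtain ⟨R, hR⟩ := hK.isBounded.exists_norm_le
    obtain ⟨C, hC0, hC⟩ := hb' R n le_rfl
    obtain ⟨D, hD⟩ := hb R (n + 2)
    have hD' : ∀ j t, |t| ≤ R → |Φ j (n + 2) t| ≤ |D| * 2 ^ j := by
      intro j t ht
      refine (hD j t ht).trans ?_
      rw [div_le_iff₀ (by positivity)]
      calc D * ((2 : ℝ) ^ j) ^ (n + 2) ≤ |D| * ((2 : ℝ) ^ j) ^ (n + 2) := by
            gcongr; exact le_abs_self D
        _ = _ := by ring
    refine ⟨4 * |D| + 8 * C, fun x h hx hp hq hh => ?_⟩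
    have hx' := hR x hx
    have hp' := hR _ hp
    have hq' := hR _ hq
    rw [Real.norm_eq_abs] at hx' hp' hq'
    set a : ℕ → ℝ := fun j => Φ j n (x + h) - 2 * Φ j n x + Φ j n (x - h) with ha
    have hsa : Summable a :=
      ((hsum n le_rfl (x + h)).sub ((hsum n le_rfl x).mul_left 2)).add (hsum n le_rfl (x - h))
    have hta : ∑' j, a j = ∑' j, Φ j n (x + h) - 2 * ∑' j, Φ j n x + ∑' j, Φ j n (x - h) := by
      rw [ha, Summable.tsum_add
        ((hsum n le_rfl (x + h)).sub ((hsum n le_rfl x).mul_left 2)) (hsum n le_rfl (x - h)),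
        Summable.tsum_sub (hsum n le_rfl (x + h)) ((hsum n le_rfl x).mul_left 2), tsum_mul_left]
    rw [← hta]
    have hA : ∀ j, |a j| ≤ 4 * C * (1 / 2) ^ j := by
      intro j
      have e1 := hC j _ hx'
      have e2 := hC j _ hp'
      have e3 := hC j _ hq'
      rw [abs_le] at *
      simp only [ha]
      constructor <;> linarith [e1.1, e1.2, e2.1, e2.2, e3.1, e3.2]
    have hB : ∀ j, |a j| ≤ 2 * |D| * h ^ 2 * 2 ^ j := by
      intro j
      have := zyg_second_diff_bound (Φ j n) (Φ j (n + 1)) (Φ j (n + 2)) (hd j n) (hd j (n + 1))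
        R (|D| * 2 ^ j) (hD' j) x h hx' hp' hq'
      refine this.trans (le_of_eq ?_)
      ring
    have hh' : 0 < |h| := abs_pos.mpr hh
    -- the cut-off index
    have hex : ∃ N : ℕ, (1 / 2 : ℝ) ^ N ≤ |h| := by
      obtain ⟨N, hN⟩ := exists_pow_lt_of_lt_one hh' (by norm_num : (1 / 2 : ℝ) < 1)
      exact ⟨N, hN.le⟩
    classical
    have hN := Nat.find_spec hex
    have hmin : (2 : ℝ) ^ (Nat.find hex) - 1 ≤ 2 / |h| := by
      rcases Nat.eq_zero_or_pos (Nat.find hex) with h0 | h0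
      · rw [h0, pow_zero, sub_self]; positivity
      · have := Nat.find_min hex (m := Nat.find hex - 1) (by omega)
        push Not at this
        obtain ⟨q, hq⟩ : ∃ q, Nat.find hex = q + 1 := ⟨Nat.find hex - 1, by omega⟩
        rw [hq] at this ⊢
        simp only [Nat.add_sub_cancel] at this
        rw [le_div_iff₀ hh']
        have h3 : (2 : ℝ) ^ q * |h| < 1 := by
          have : (2 : ℝ) ^ q * |h| < 2 ^ q * (1 / 2) ^ q := by gcongr
          rwa [← mul_pow, show (2 : ℝ) * (1 / 2) = 1 by norm_num, one_pow] at this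
        rw [pow_succ]
        nlinarith
    set N := Nat.find hex
    rw [← hsa.sum_add_tsum_nat_add N]
    have hfin : |∑ j ∈ Finset.range N, a j| ≤ 4 * |D| * |h| := by
      calc |∑ j ∈ Finset.range N, a j| ≤ ∑ j ∈ Finset.range N, |a j| :=
            Finset.abs_sum_le_sum_abs _ _
        _ ≤ ∑ j ∈ Finset.range N, 2 * |D| * h ^ 2 * 2 ^ j := Finset.sum_le_sum fun j _ => hB j
        _ = 2 * |D| * |h| ^ 2 * (2 ^ N - 1) := by
            rw [← Finset.mul_sum, geom_sum_eq (by norm_num), sq_abs]; norm_num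
        _ ≤ 2 * |D| * |h| ^ 2 * (2 / |h|) := by gcongr
        _ = _ := by field_simp; ring
    have htail : |∑' j, a (j + N)| ≤ 8 * C * |h| := by
      have hs2 : Summable (fun j : ℕ => 4 * C * |h| * (1 / 2 : ℝ) ^ j) := hgeo _
      have hle : ∀ j, ‖a (j + N)‖ ≤ 4 * C * |h| * (1 / 2 : ℝ) ^ j := by
        intro j
        refine (hA (j + N)).trans ?_
        rw [pow_add]
        calc 4 * C * ((1 / 2 : ℝ) ^ j * (1 / 2) ^ N) ≤ 4 * C * ((1 / 2 : ℝ) ^ j * |h|) := by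
              gcongr
          _ = _ := by ring
      have := tsum_of_norm_bounded hs2.hasSum hle
      rw [tsum_mul_left, tsum_geometric_of_lt_one (by norm_num) (by norm_num)] at this
      rw [← Real.norm_eq_abs]
      refine this.trans (le_of_eq ?_)
      norm_num
      ring
    calc _ ≤ |∑ j ∈ Finset.range N, a j| + |∑' j, a (j + N)| := abs_add_le _ _
      _ ≤ _ := by linarith

lemma fwdDiff_iter_bound (m : ℕ) : ∀ (y : ℝ → ℝ), ContDiff ℝ m y → ∀ (t h M : ℝ), 0 ≤ h →
    (∀ ξ ∈ Set.Icc t (t + m * h), |iteratedDeriv m y ξ| ≤ M) →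
    |(fwdDiff h)^[m] y t| ≤ M * h ^ m := by
  induction m with
  | zero =>
    intro y _ t h M hh hM
    simpa using hM t (by simp)
  | succ m ih =>
    intro y hy t h M hh hM
    rw [Function.iterate_succ_apply]
    have hy' : ContDiff ℝ m y := hy.of_le (by norm_cast; omega)
    have hys : ContDiff ℝ m (fun z => y (z + h)) := hy'.comp (contDiff_id.add contDiff_const)
    have key := ih (fwdDiff h y) (hys.sub hy') t h (M * h) hh ?_
    · refine key.trans (le_of_eq ?_)
      ring
    · intro ξ hξ
      have e : iteratedDeriv m (fwdDiff h y) ξ = iteratedDeriv m y (ξ + h) - iteratedDeriv m y ξ := by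
        have : fwdDiff h y = (fun z => y (z + h)) - y := rfl
        rw [this, iteratedDeriv_sub hys.contDiffAt hy'.contDiffAt, iteratedDeriv_comp_add_const]
      rw [e]
      have hdiff : Differentiable ℝ (iteratedDeriv m y) :=
        hy.differentiable_iteratedDeriv m (by norm_cast; omega)
      have := Convex.norm_image_sub_le_of_norm_deriv_le (f := iteratedDeriv m y)
        (s := Set.Icc t (t + (m + 1 : ℕ) * h)) (C := M) (x := ξ) (y := ξ + h)
        (fun z _ => hdiff z) (fun z hz => by
          rw [← iteratedDeriv_succ]
          exact hM z hz) (convex_Icc _ _)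
        (by
          push_cast
          constructor <;> nlinarith [hξ.1, hξ.2])
        (by
          push_cast
          constructor <;> nlinarith [hξ.1, hξ.2])
      simpa [abs_of_nonneg hh] using this

lemma zyg_fwdDiff (m : ℕ) (u : ℝ → ℝ) (hu : ZygmundClassR m u) :
    ∃ C : ℝ, 0 ≤ C ∧ ∀ t h : ℝ, 0 ≤ t → 0 < h → t + (m + 2) * h ≤ 2 →
      |(fwdDiff h)^[m + 2] u t| ≤ C * h ^ (m + 1) := by
  obtain ⟨hu1, hu2⟩ := hu
  obtain ⟨C, hC⟩ := hu2 (Set.Icc 0 2) isCompact_Icc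
  refine ⟨|C|, abs_nonneg _, fun t h ht hh h2 => ?_⟩
  rw [Function.iterate_add_apply]
  have c1 : ContDiff ℝ m (fun z => u (z + h + h)) :=
    hu1.comp ((contDiff_id.add contDiff_const).add contDiff_const)
  have c2 : ContDiff ℝ m (fun z => u (z + h)) := hu1.comp (contDiff_id.add contDiff_const)
  have e : (fwdDiff h)^[2] u = ((fun z => u (z + h + h)) - fun z => u (z + h)) -
      ((fun z => u (z + h)) - u) := by
    funext z
    simp [fwdDiff]
  have := fwdDiff_iter_bound m ((fwdDiff h)^[2] u) (by rw [e]; exact (c1.sub c2).sub (c2.sub hu1))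
    t h (|C| * h) hh.le ?_
  · refine this.trans (le_of_eq ?_)
    ring
  · intro ξ hξ
    have c3 : ContDiff ℝ m ((fun z => u (z + h + h)) - fun z => u (z + h)) := c1.sub c2
    have c4 : ContDiff ℝ m ((fun z => u (z + h)) - u) := c2.sub hu1
    rw [e, iteratedDeriv_sub c3.contDiffAt c4.contDiffAt,
      iteratedDeriv_sub c1.contDiffAt c2.contDiffAt, iteratedDeriv_sub c2.contDiffAt hu1.contDiffAt,
      iteratedDeriv_comp_add_const]
    have e3 : iteratedDeriv m (fun z => u (z + h + h)) ξ = iteratedDeriv m u (ξ + h + h) := by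
      have := congrFun (iteratedDeriv_comp_add_const m u (h + h)) ξ
      simpa [add_assoc] using this
    rw [e3]
    have := hC (ξ + h) h ⟨by linarith [hξ.1], by nlinarith [hξ.2]⟩
      ⟨by linarith [hξ.1], by nlinarith [hξ.2]⟩
      ⟨by linarith [hξ.1], by nlinarith [hξ.2]⟩ hh.ne'
    rw [abs_of_pos hh, add_sub_cancel_right] at this
    calc _ = |iteratedDeriv m u (ξ + h + h) - 2 * iteratedDeriv m u (ξ + h)
          + iteratedDeriv m u ξ| := by ring_nf
      _ ≤ C * h := this
      _ ≤ _ := by gcongr; exact le_abs_self C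

/-! ### A curve lemma and its consequences -/

lemma bump_iter_bounded (χ : ℝ → ℝ) (h1 : ContDiff ℝ (⊤ : ℕ∞) χ) (h2 : HasCompactSupport χ)
    (k : ℕ) : ∃ C : ℝ, ∀ x, ‖iteratedDeriv k χ x‖ ≤ C := by
  have h3 : HasCompactSupport (iteratedFDeriv ℝ k χ) := h2.iteratedFDeriv k
  have h4 : Continuous (iteratedFDeriv ℝ k χ) :=
    h1.continuous_iteratedFDeriv (by exact_mod_cast le_top)
  obtain ⟨C, hC⟩ := h4.bounded_above_of_compact_support h3
  exact ⟨C, fun x => by rw [← norm_iteratedFDeriv_eq_norm_iteratedDeriv]; exact hC x⟩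

lemma bump_one_exists : ∃ χ : ℝ → ℝ, ContDiff ℝ (⊤ : ℕ∞) χ ∧ HasCompactSupport χ ∧
    (∀ u, |u - 1| ≤ 1 / 8 → χ u = 1) ∧ (∀ u, 1 / 4 ≤ |u - 1| → χ u = 0) := by
  let B : ContDiffBump (1 : ℝ) := ⟨1 / 8, 1 / 4, by norm_num, by norm_num⟩
  exact ⟨B, B.contDiff, B.hasCompactSupport, fun u hu =>
    B.one_of_mem_closedBall (by rw [Metric.mem_closedBall, Real.dist_eq]; exact hu), fun u hu =>
    B.zero_of_le_dist (by rw [Real.dist_eq]; exact hu)⟩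

lemma curve_exists {E : Type*} [NormedAddCommGroup E] [NormedSpace ℝ E] [CompleteSpace E]
    (p : E) (a b : ℕ → E) (ha : ∀ n, ‖a n‖ ≤ 1) (hb : ∀ n, ‖b n‖ ≤ 1) :
    ∃ c : ℝ → E, ContDiff ℝ (⊤ : ℕ∞) c ∧ c 0 = p ∧
      ∀ (n : ℕ) (τ : ℝ), |2 ^ n * τ - 1| ≤ 1 / 8 →
        c τ = p + ((n.factorial : ℝ))⁻¹ • (a n + (2 ^ n * τ - 1) • b n) := by
  obtain ⟨χ, hχ, hχs, hχ1, hχ0⟩ := bump_one_exists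
  let ψ : ℝ → ℝ := fun u => (u - 1) * χ u
  have hψ : ContDiff ℝ (⊤ : ℕ∞) ψ := (contDiff_id.sub contDiff_const).mul hχ
  have hψs : HasCompactSupport ψ := hχs.mul_left
  let H : ℕ → ℝ → E := fun n u => χ u • a n + ψ u • b n
  have hH : ∀ n, ContDiff ℝ (⊤ : ℕ∞) (H n) := fun n =>
    (hχ.smul contDiff_const).add (hψ.smul contDiff_const)
  let F : ℕ → ℝ → E := fun n τ => ((n.factorial : ℝ))⁻¹ • H n (2 ^ n * τ)
  have hF : ∀ n, ContDiff ℝ (⊤ : ℕ∞) (F n) := fun n =>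
    ((hH n).comp (contDiff_const.mul contDiff_id)).const_smul _
  choose C1 hC1 using bump_iter_bounded χ hχ hχs
  choose C2 hC2 using bump_iter_bounded ψ hψ hψs
  have hbound : ∀ (k n : ℕ) (τ : ℝ), ‖iteratedFDeriv ℝ k (F n) τ‖ ≤
      (C1 k + C2 k) * (((2 : ℝ) ^ k) ^ n / n.factorial) := by
    intro k n τ
    have hk : ((k : ℕ∞) : WithTop ℕ∞) ≤ ((⊤ : ℕ∞) : WithTop ℕ∞) := by exact_mod_cast le_top
    have hHk : ContDiff ℝ k (H n) := (hH n).of_le hk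
    have hχk : ContDiff ℝ k χ := hχ.of_le hk
    have hψk : ContDiff ℝ k ψ := hψ.of_le hk
    rw [norm_iteratedFDeriv_eq_norm_iteratedDeriv]
    have e1 : iteratedDeriv k (F n) τ =
        ((n.factorial : ℝ))⁻¹ • ((2 : ℝ) ^ n) ^ k • iteratedDeriv k (H n) (2 ^ n * τ) := by
      have h1 := iteratedDeriv_fun_const_smul_field (n := k) (x := τ) ((n.factorial : ℝ))⁻¹
        (fun τ => H n (2 ^ n * τ))
      have h2 := iteratedDeriv_comp_const_smul hHk ((2 : ℝ) ^ n)
      rw [h2] at h1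
      exact h1
    have e2 : ∀ u, iteratedDeriv k (H n) u = iteratedDeriv k χ u • a n + iteratedDeriv k ψ u • b n := by
      intro u
      have := iteratedDeriv_fun_add (n := k) (x := u) (f := fun u => χ u • a n) (g := fun u => ψ u • b n)
        (hχk.smul contDiff_const).contDiffAt (hψk.smul contDiff_const).contDiffAt
      rw [iteratedDeriv_smul_const hχk.contDiffAt, iteratedDeriv_smul_const hψk.contDiffAt] at this
      exact this
    have e3 : ∀ u, ‖iteratedDeriv k (H n) u‖ ≤ C1 k + C2 k := by
      intro u
      rw [e2]
      refine (norm_add_le _ _).trans (add_le_add ?_ ?_)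
      · rw [norm_smul]
        exact (mul_le_of_le_one_right (norm_nonneg _) (ha n)).trans (hC1 k u)
      · rw [norm_smul]
        exact (mul_le_of_le_one_right (norm_nonneg _) (hb n)).trans (hC2 k u)
    have e4 : ((2 : ℝ) ^ n) ^ k = ((2 : ℝ) ^ k) ^ n := pow_right_comm 2 n k
    have e5 := e3 (2 ^ n * τ)
    have e6 : (0 : ℝ) ≤ ((2 : ℝ) ^ k) ^ n := by positivity
    have e7 : (0 : ℝ) ≤ ((n.factorial : ℝ))⁻¹ := by positivity
    rw [e1, e4, norm_smul, norm_smul, Real.norm_of_nonneg e6, Real.norm_of_nonneg e7]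
    calc _ ≤ ((n.factorial : ℝ))⁻¹ * (((2 : ℝ) ^ k) ^ n * (C1 k + C2 k)) :=
          mul_le_mul_of_nonneg_left (mul_le_mul_of_nonneg_left e5 e6) e7
      _ = _ := by ring
  have hsv : ∀ k : ℕ, Summable (fun n : ℕ =>
      (C1 k + C2 k) * (((2 : ℝ) ^ k) ^ n / (n.factorial : ℝ))) := by
    intro k
    have := Real.summable_pow_div_factorial ((2 : ℝ) ^ k)
    exact this.mul_left (C1 k + C2 k)
  have hsm : ContDiff ℝ (⊤ : ℕ∞) (fun τ => ∑' n, F n τ) := by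
    refine contDiff_tsum (v := fun (k n : ℕ) => (C1 k + C2 k) * (((2 : ℝ) ^ k) ^ n / (n.factorial : ℝ)))
      hF (fun k _ => hsv k) (fun k n τ _ => hbound k n τ)
  have hzero : ∀ (n : ℕ) (u : ℝ), 1 / 4 ≤ |u - 1| → H n u = 0 := by
    intro n u hu
    simp [H, ψ, hχ0 u hu]
  refine ⟨fun τ => p + ∑' n, F n τ, contDiff_const.add hsm, ?_, ?_⟩
  · have : ∀ n, F n 0 = 0 := by
      intro n
      simp only [F, mul_zero]
      rw [hzero n 0 (by norm_num), smul_zero]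
    simp [this]
  · intro n τ hτ
    have hτ' := abs_le.1 hτ
    have h0 : ∀ k, k ≠ n → F k τ = 0 := by
      intro k hk
      have : 1 / 4 ≤ |2 ^ k * τ - 1| := by
        rcases lt_or_gt_of_ne hk with hlt | hlt
        · obtain ⟨q, rfl⟩ := Nat.exists_eq_add_of_lt hlt
          have h2q : (1 : ℝ) ≤ 2 ^ q := one_le_pow₀ (by norm_num)
          have e : (2 : ℝ) ^ (k + q + 1) * τ = 2 * (2 ^ q * (2 ^ k * τ)) := by ring
          rw [e] at hτ'
          rw [abs_sub_comm]
          refine le_trans ?_ (le_abs_self _)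
          by_contra hcon
          push Not at hcon
          nlinarith
        · obtain ⟨q, rfl⟩ := Nat.exists_eq_add_of_lt hlt
          have h2q : (1 : ℝ) ≤ 2 ^ q := one_le_pow₀ (by norm_num)
          have e : (2 : ℝ) ^ (n + q + 1) * τ = 2 * (2 ^ q * (2 ^ n * τ)) := by ring
          rw [e]
          refine le_trans ?_ (le_abs_self _)
          nlinarith
      simp only [F]
      rw [hzero k _ this, smul_zero]
    show p + ∑' k, F k τ = _
    rw [tsum_eq_single n h0]
    simp only [F, H, ψ, hχ1 _ hτ, one_smul, mul_one]

section curve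

variable {E : Type*} [NormedAddCommGroup E] [NormedSpace ℝ E] [CompleteSpace E]

lemma continuous_of_curves (g : E → ℝ)
    (hg : ∀ c : ℝ → E, ContDiff ℝ (⊤ : ℕ∞) c → Continuous (g ∘ c)) : Continuous g := by
  rw [continuous_iff_continuousAt]
  intro p
  rw [Metric.continuousAt_iff]
  by_contra hcon
  push Not at hcon
  obtain ⟨ε, hε, h⟩ := hcon
  have h' : ∀ n : ℕ, ∃ x, dist x p < ((n.factorial : ℝ))⁻¹ ∧ ε ≤ dist (g x) (g p) :=
    fun n => h _ (by positivity)
  choose x hx1 hx2 using h'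
  obtain ⟨c, hc, hc0, hcn⟩ := curve_exists p (fun n => (n.factorial : ℝ) • (x n - p)) (fun _ => 0)
    (fun n => by
      rw [norm_smul, Real.norm_natCast, ← dist_eq_norm]
      have hpos : (0 : ℝ) < n.factorial := by positivity
      have := (hx1 n).le
      calc (n.factorial : ℝ) * dist (x n) p ≤ n.factorial * ((n.factorial : ℝ))⁻¹ := by gcongr
        _ = 1 := mul_inv_cancel₀ hpos.ne')
    (fun n => by simp)
  have hcx : ∀ n : ℕ, c ((1 / 2) ^ n) = x n := by
    intro n
    have e : (2 : ℝ) ^ n * (1 / 2) ^ n = 1 := by rw [← mul_pow]; norm_num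
    rw [hcn n _ (by rw [e]; norm_num)]
    have hpos : ((n.factorial : ℝ)) ≠ 0 := by positivity
    rw [smul_zero, add_zero, smul_smul, inv_mul_cancel₀ hpos, one_smul, add_sub_cancel]
  have hl : Filter.Tendsto (fun n : ℕ => g (c ((1 / 2 : ℝ) ^ n))) Filter.atTop (nhds (g (c 0))) :=
    ((hg c hc).tendsto 0).comp
      (tendsto_pow_atTop_nhds_zero_of_lt_one (by norm_num) (by norm_num))
  simp only [hcx, hc0] at hl
  obtain ⟨N, hN⟩ := (Metric.tendsto_atTop.1 hl) ε hε
  exact absurd (hN N le_rfl) (not_lt.2 (hx2 N))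

lemma local_diff_bound (m : ℕ) (g : E → ℝ)
    (hg : ∀ c : ℝ → E, ContDiff ℝ (⊤ : ℕ∞) c → ZygmundClassR m (g ∘ c)) (p : E) :
    ∃ δ > 0, ∃ C : ℝ, ∀ x v : E, dist x p < δ → ‖v‖ < δ →
      |(fwdDiff v)^[m + 2] g x| ≤ C * ‖v‖ ^ (m + 1) := by
  by_contra hcon
  push Not at hcon
  have h' : ∀ n : ℕ, ∃ x v : E, dist x p < (8 * (m + 2) * (n.factorial : ℝ))⁻¹ ∧
      ‖v‖ < (8 * (m + 2) * (n.factorial : ℝ))⁻¹ ∧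
      (n * (n.factorial : ℝ) ^ (m + 1)) * ‖v‖ ^ (m + 1) < |(fwdDiff v)^[m + 2] g x| :=
    fun n => hcon _ (by positivity) _
  choose x v hx hv hxv using h'
  have hfac : ∀ n : ℕ, (0 : ℝ) < n.factorial := fun n => by positivity
  obtain ⟨c, hc, hc0, hcn⟩ := curve_exists p (fun n => (n.factorial : ℝ) • (x n - p))
    (fun n => ‖v n‖⁻¹ • v n)
    (fun n => by
      rw [norm_smul, Real.norm_natCast, ← dist_eq_norm]
      have := (hx n).le
      calc (n.factorial : ℝ) * dist (x n) p ≤ n.factorial * (8 * (m + 2) * (n.factorial : ℝ))⁻¹ := by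
            gcongr
        _ = (8 * (m + 2) : ℝ)⁻¹ := by have := (hfac n).ne'; field_simp
        _ ≤ 1 := by
          apply inv_le_one_of_one_le₀
          have : (0 : ℝ) ≤ m := by positivity
          linarith)
    (fun n => by
      rw [norm_smul, norm_inv, norm_norm]
      exact inv_mul_le_one)
  obtain ⟨C, hC0, hC⟩ := zyg_fwdDiff m _ (hg c hc)
  obtain ⟨n, hn⟩ := exists_nat_gt C
  have hvn : 0 < ‖v n‖ := by
    rw [norm_pos_iff]
    intro h0
    have h1 := hxv n
    have h2 : (fwdDiff (v n))^[m + 2] g (x n) = 0 := by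
      rw [h0, Function.iterate_succ_apply']
      simp [fwdDiff]
    rw [h2, h0] at h1
    simp at h1
  set h : ℝ := n.factorial * ‖v n‖ * (1 / 2) ^ n with hh
  have hhpos : 0 < h := by have := hfac n; positivity
  have e2 : (2 : ℝ) ^ n * (1 / 2) ^ n = 1 := by rw [← mul_pow]; norm_num
  have e2h : (2 : ℝ) ^ n * h = n.factorial * ‖v n‖ := by
    rw [hh]
    calc _ = n.factorial * ‖v n‖ * ((2 : ℝ) ^ n * (1 / 2) ^ n) := by ring
      _ = _ := by rw [e2, mul_one]
  have hsmall : (m + 2) * (n.factorial * ‖v n‖) ≤ 1 / 8 := by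
    have := (hv n).le
    calc (m + 2) * (n.factorial * ‖v n‖)
        ≤ (m + 2) * (n.factorial * (8 * (m + 2) * (n.factorial : ℝ))⁻¹) := by gcongr
      _ = 1 / 8 := by
        have := (hfac n).ne'
        field_simp
  have hhalf : (1 / 2 : ℝ) ^ n ≤ 1 := pow_le_one₀ (by norm_num) (by norm_num)
  have hhalf0 : (0 : ℝ) ≤ (1 / 2 : ℝ) ^ n := by positivity
  have key := hC ((1 / 2) ^ n) h (by positivity) hhpos (by
    have : (m + 2) * h = (m + 2) * (n.factorial * ‖v n‖) * (1 / 2) ^ n := by rw [hh]; ring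
    rw [this]
    nlinarith)
  have heq : (fwdDiff h)^[m + 2] (g ∘ c) ((1 / 2) ^ n) = (fwdDiff (v n))^[m + 2] g (x n) := by
    rw [fwdDiff_iter_eq_sum_shift, fwdDiff_iter_eq_sum_shift]
    refine Finset.sum_congr rfl fun k hk => ?_
    congr 1
    rw [Finset.mem_range] at hk
    have hk' : (k : ℝ) ≤ m + 2 := by
      have : k ≤ m + 2 := by omega
      exact_mod_cast this
    have e3 : (2 : ℝ) ^ n * ((1 / 2) ^ n + k • h) - 1 = k * (n.factorial * ‖v n‖) := by
      rw [nsmul_eq_mul]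
      calc _ = (2 : ℝ) ^ n * (1 / 2) ^ n - 1 + k * (2 ^ n * h) := by ring
        _ = _ := by rw [e2, e2h]; ring
    have hpos : 0 ≤ n.factorial * ‖v n‖ := by positivity
    simp only [Function.comp]
    rw [hcn n _ (by
      rw [e3, abs_of_nonneg (by positivity)]
      exact (mul_le_mul_of_nonneg_right hk' hpos).trans hsmall), e3]
    congr 1
    rw [smul_add, smul_smul, inv_mul_cancel₀ (hfac n).ne', one_smul, smul_smul, smul_smul,
      ← add_assoc, add_sub_cancel, ← Nat.cast_smul_eq_nsmul ℝ]
    congr 2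
    have := (hfac n).ne'
    field_simp
  rw [heq] at key
  have h1 := hxv n
  have h2 : C * h ^ (m + 1) ≤ n * (n.factorial : ℝ) ^ (m + 1) * ‖v n‖ ^ (m + 1) := by
    have : h ≤ n.factorial * ‖v n‖ := by
      rw [hh]
      exact mul_le_of_le_one_right (by positivity) hhalf
    calc C * h ^ (m + 1) ≤ n * (n.factorial * ‖v n‖) ^ (m + 1) := by gcongr
      _ = _ := by rw [mul_pow]; ring
  linarith

lemma compact_diff_bound [ProperSpace E] (m : ℕ) (g : E → ℝ)
    (hg : ∀ c : ℝ → E, ContDiff ℝ (⊤ : ℕ∞) c → ZygmundClassR m (g ∘ c)) (R S : ℝ) :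
    ∃ C : ℝ, 0 ≤ C ∧ ∀ x v : E, ‖x‖ ≤ R → ‖v‖ ≤ S →
      |(fwdDiff v)^[m + 2] g x| ≤ C * ‖v‖ ^ (m + 1) := by
  have hcont : Continuous g := continuous_of_curves g fun c hc => (hg c hc).1.continuous
  have h1 : ∃ δ > 0, ∃ C : ℝ, ∀ x ∈ Metric.closedBall (0 : E) R, ∀ v : E, ‖v‖ < δ →
      |(fwdDiff v)^[m + 2] g x| ≤ C * ‖v‖ ^ (m + 1) := by
    refine (isCompact_closedBall (0 : E) R).induction_on (p := fun s => ∃ δ > 0, ∃ C : ℝ, ∀ x ∈ s,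
      ∀ v : E, ‖v‖ < δ → |(fwdDiff v)^[m + 2] g x| ≤ C * ‖v‖ ^ (m + 1)) ?_ ?_ ?_ ?_
    · exact ⟨1, one_pos, 0, by simp⟩
    · rintro s t hst ⟨δ, hδ, C, hC⟩
      exact ⟨δ, hδ, C, fun x hx => hC x (hst hx)⟩
    · rintro s t ⟨δ, hδ, C, hC⟩ ⟨δ', hδ', C', hC'⟩
      refine ⟨min δ δ', lt_min hδ hδ', max C C', ?_⟩
      rintro x (hx | hx) v hv
      · refine (hC x hx v (hv.trans_le (min_le_left _ _))).trans ?_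
        gcongr; exact le_max_left _ _
      · refine (hC' x hx v (hv.trans_le (min_le_right _ _))).trans ?_
        gcongr; exact le_max_right _ _
    · intro p _
      obtain ⟨δ, hδ, C, hC⟩ := local_diff_bound m g hg p
      exact ⟨Metric.ball p δ, mem_nhdsWithin_of_mem_nhds (Metric.ball_mem_nhds p hδ), δ, hδ, C,
        fun x hx v hv => hC x v hx hv⟩
  obtain ⟨δ, hδ, C, hC⟩ := h1
  have hc2 : Continuous (fun q : E × E => (fwdDiff q.2)^[m + 2] g q.1) := by
    simp only [fwdDiff_iter_eq_sum_shift]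
    fun_prop
  obtain ⟨M, hM⟩ := ((isCompact_closedBall (0 : E) R).prod
    (isCompact_closedBall (0 : E) S)).exists_bound_of_continuousOn hc2.continuousOn
  refine ⟨max |C| (|M| / δ ^ (m + 1)), le_max_of_le_left (abs_nonneg _), fun x v hx hv => ?_⟩
  by_cases hvδ : ‖v‖ < δ
  · refine (hC x (by simpa using hx) v hvδ).trans ?_
    gcongr
    exact (le_abs_self C).trans (le_max_left _ _)
  · push Not at hvδ
    have h3 := hM (x, v) ⟨by simpa using hx, by simpa using hv⟩
    calc |(fwdDiff v)^[m + 2] g x| ≤ |M| := le_trans h3 (le_abs_self M)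
      _ = |M| / δ ^ (m + 1) * δ ^ (m + 1) := by field_simp
      _ ≤ max |C| (|M| / δ ^ (m + 1)) * ‖v‖ ^ (m + 1) := by
        gcongr
        exact le_max_right _ _

end curve

/-! ### Mollification -/

section mollify

open MeasureTheory Module

variable {E : Type*} [NormedAddCommGroup E] [NormedSpace ℝ E] [FiniteDimensional ℝ E]
  [MeasurableSpace E] [BorelSpace E] (μ : Measure E) [μ.IsAddHaarMeasure]

/-- Average of `w` at scale `ε` against the kernel `ψ`. -/
noncomputable def mol (ψ : E → ℝ) (ε : ℝ) (w : E → ℝ) (p : E) : ℝ :=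
  ∫ y, ψ y * w (p - ε • y) ∂μ

/-- Directional derivative of a kernel. -/
noncomputable def dirD (e : E) (ψ : E → ℝ) : E → ℝ := fun y => fderiv ℝ ψ y e

lemma dirD_contDiff (e : E) (ψ : E → ℝ) (h : ContDiff ℝ (⊤ : ℕ∞) ψ) :
    ContDiff ℝ (⊤ : ℕ∞) (dirD e ψ) :=
  (h.fderiv_right (m := (⊤ : ℕ∞)) (by norm_cast)).clm_apply contDiff_const

lemma dirD_compact (e : E) (ψ : E → ℝ) (h : HasCompactSupport ψ) :
    HasCompactSupport (dirD e ψ) := h.fderiv_apply (𝕜 := ℝ) e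

lemma mol_eq (ψ : E → ℝ) (ε : ℝ) (hε : ε ≠ 0) (w : E → ℝ) (p : E) :
    mol μ ψ ε w p = |(ε ^ finrank ℝ E)⁻¹| * ∫ t, w t * ψ (ε⁻¹ • (p - t)) ∂μ := by
  have h1 := Measure.integral_comp_smul μ (fun z => w (p - z) * ψ (ε⁻¹ • z)) ε
  have h2 := integral_sub_left_eq_self (fun t => w t * ψ (ε⁻¹ • (p - t))) μ p
  simp only [sub_sub_cancel] at h2
  rw [h2] at h1
  rw [smul_eq_mul] at h1
  rw [← h1, mol]
  congr 1
  funext y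
  rw [smul_smul, inv_mul_cancel₀ hε, one_smul, mul_comm]

lemma mol_hasFDerivAt (ψ : E → ℝ) (hψ : ContDiff ℝ (⊤ : ℕ∞) ψ) (hs : HasCompactSupport ψ)
    (ε : ℝ) (hε : ε ≠ 0) (w : E → ℝ) (hw : Continuous w) (p : E) :
    ∃ L : E →L[ℝ] ℝ, HasFDerivAt (mol μ ψ ε w) L p ∧
      ∀ e, L e = ε⁻¹ * mol μ (dirD e ψ) ε w p := by
  let ψε : E → ℝ := fun z => ψ (ε⁻¹ • z)
  have c1 : ContDiff ℝ (⊤ : ℕ∞) ψε := hψ.comp (contDiff_const_smul _)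
  have c2 : HasCompactSupport ψε := hs.comp_smul (inv_ne_zero hε)
  have c1' : ContDiff ℝ 1 ψε := c1.of_le (by exact_mod_cast le_top)
  have hli : LocallyIntegrable w μ := hw.locallyIntegrable
  have key := c2.hasFDerivAt_convolution_right (ContinuousLinearMap.lsmul ℝ ℝ) hli c1' p
  have e0 : mol μ ψ ε w = fun q => |(ε ^ finrank ℝ E)⁻¹| *
      (convolution w ψε (ContinuousLinearMap.lsmul ℝ ℝ) μ) q := by
    funext q
    rw [mol_eq μ ψ ε hε]
    rfl
  refine ⟨_, by rw [e0]; exact key.const_mul _, fun e => ?_⟩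
  rw [ContinuousLinearMap.smul_apply, convolution_precompR_apply _ hli (c2.fderiv ℝ)
    (c1'.continuous_fderiv one_ne_zero), mol_eq μ _ ε hε, smul_eq_mul, mul_left_comm,
    ← integral_const_mul]
  congr 1
  unfold convolution
  congr 1
  funext t
  have hfd : ∀ z, fderiv ℝ ψε z e = ε⁻¹ * fderiv ℝ ψ (ε⁻¹ • z) e := by
    intro z
    have := fderiv_comp_smul (f := ψ) ε⁻¹ (x := z)
    simp only [ψε]
    rw [this]
    simp
  simp only [ContinuousLinearMap.lsmul_apply, smul_eq_mul, dirD]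
  rw [hfd]
  ring

lemma mol_continuous (ψ : E → ℝ) (hψ : ContDiff ℝ (⊤ : ℕ∞) ψ) (hs : HasCompactSupport ψ)
    (ε : ℝ) (hε : ε ≠ 0) (w : E → ℝ) (hw : Continuous w) : Continuous (mol μ ψ ε w) := by
  rw [continuous_iff_continuousAt]
  intro p
  obtain ⟨L, hL, -⟩ := mol_hasFDerivAt μ ψ hψ hs ε hε w hw p
  exact hL.continuousAt

lemma mol_hasDerivAt (ψ : E → ℝ) (hψ : ContDiff ℝ (⊤ : ℕ∞) ψ) (hs : HasCompactSupport ψ)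
    (ε : ℝ) (hε : ε ≠ 0) (w : E → ℝ) (hw : Continuous w) (p e : E) (s : ℝ) :
    HasDerivAt (fun s : ℝ => mol μ ψ ε w (p + s • e))
      (ε⁻¹ * mol μ (dirD e ψ) ε w (p + s • e)) s := by
  obtain ⟨L, hL, hLe⟩ := mol_hasFDerivAt μ ψ hψ hs ε hε w hw (p + s • e)
  have h1 : HasDerivAt (fun s : ℝ => p + s • e) e s := by
    simpa using ((hasDerivAt_id s).smul_const e).const_add p
  have := hL.comp_hasDerivAt s h1
  rw [hLe] at this
  exact this

lemma mol_integrable (ψ : E → ℝ) (hψ : Continuous ψ) (hs : HasCompactSupport ψ)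
    (ε : ℝ) (w : E → ℝ) (hw : Continuous w) (p : E) :
    Integrable (fun y => ψ y * w (p - ε • y)) μ := by
  refine Continuous.integrable_of_hasCompactSupport (by fun_prop) ?_
  exact hs.mul_right

lemma mol_sub (ψ : E → ℝ) (hψ : Continuous ψ) (hs : HasCompactSupport ψ)
    (ε : ℝ) (w w' : E → ℝ) (hw : Continuous w) (hw' : Continuous w') (p : E) :
    mol μ ψ ε (fun q => w q - w' q) p = mol μ ψ ε w p - mol μ ψ ε w' p := by
  unfold mol
  rw [← integral_sub (mol_integrable μ ψ hψ hs ε w hw p) (mol_integrable μ ψ hψ hs ε w' hw' p)]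
  congr 1
  funext y
  ring

lemma mol_comm (ψ χ : E → ℝ) (hψ : Continuous ψ) (hs : HasCompactSupport ψ)
    (hχ : Continuous χ) (hs' : HasCompactSupport χ)
    (ε δ : ℝ) (w : E → ℝ) (hw : Continuous w) (p : E) :
    mol μ ψ ε (mol μ χ δ w) p = mol μ χ δ (mol μ ψ ε w) p := by
  unfold mol
  simp_rw [← integral_const_mul]
  rw [integral_integral_swap_of_hasCompactSupport]
  · congr 1
    funext z
    congr 1
    funext y
    rw [sub_right_comm]
    ring
  · simp only [Function.uncurry_def]
    fun_prop
  · refine HasCompactSupport.intro (K := tsupport ψ ×ˢ tsupport χ)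
      (hs.isCompact.prod hs'.isCompact) ?_
    rintro ⟨y, z⟩ hyz
    simp only [Set.mem_prod, not_and_or] at hyz
    simp only [Function.uncurry_apply_pair]
    rcases hyz with h | h
    · rw [image_eq_zero_of_notMem_tsupport h, zero_mul]
    · rw [image_eq_zero_of_notMem_tsupport h, zero_mul, mul_zero]

lemma mol_bound (ψ : E → ℝ) (hψ : Continuous ψ) (hs : HasCompactSupport ψ) :
    ∃ I ρ : ℝ, 0 ≤ I ∧ 0 ≤ ρ ∧ ∀ (w : E → ℝ) (R M ε : ℝ), 0 < ε → ε ≤ 1 →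
      (∀ p, ‖p‖ ≤ R + ρ → |w p| ≤ M) → ∀ p, ‖p‖ ≤ R → |mol μ ψ ε w p| ≤ I * M := by
  obtain ⟨ρ, hρ⟩ := hs.isCompact.isBounded.exists_norm_le
  refine ⟨∫ y, |ψ y| ∂μ, |ρ|, integral_nonneg fun y => abs_nonneg _, abs_nonneg _, ?_⟩
  intro w R M ε hε hε1 hw p hp
  rw [mol, ← integral_mul_const, ← Real.norm_eq_abs]
  refine norm_integral_le_of_norm_le ?_ (Filter.Eventually.of_forall fun y => ?_)
  · have : Integrable ψ μ := hψ.integrable_of_hasCompactSupport hs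
    exact this.abs.mul_const _
  · rw [norm_mul, Real.norm_eq_abs, Real.norm_eq_abs]
    by_cases hy : ψ y = 0
    · simp [hy]
    · refine mul_le_mul_of_nonneg_left (hw _ ?_) (abs_nonneg _)
      refine (norm_sub_le _ _).trans (add_le_add hp ?_)
      rw [norm_smul, Real.norm_of_nonneg hε.le]
      have h1 := hρ y (subset_tsupport _ hy)
      calc ε * ‖y‖ ≤ 1 * ‖y‖ := by gcongr
        _ ≤ |ρ| := by rw [one_mul]; exact h1.trans (le_abs_self ρ)

lemma kernel_exists (m : ℕ) : ∃ K : E → ℝ, ContDiff ℝ (⊤ : ℕ∞) K ∧ HasCompactSupport K ∧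
    ∀ (g : E → ℝ), Continuous g → ∀ (R C : ℝ), 
      (∀ x v : E, ‖x‖ ≤ R → ‖v‖ ≤ 1 → |(fwdDiff v)^[m + 2] g x| ≤ C * ‖v‖ ^ (m + 1)) →
      0 ≤ C → ∀ (p : E) (ε : ℝ), ‖p‖ ≤ R → 0 < ε → ε ≤ 1 →
        |mol μ K ε g p - g p| ≤ C * ε ^ (m + 1) := by
  obtain ⟨φ, hφ, hφs, hφ0, hφ1, hφb⟩ : ∃ φ : E → ℝ, ContDiff ℝ (⊤ : ℕ∞) φ ∧
      HasCompactSupport φ ∧ (∀ y, 0 ≤ φ y) ∧ ∫ y, φ y ∂μ = 1 ∧ ∀ y, φ y ≠ 0 → ‖y‖ ≤ 1 := by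
    let B : ContDiffBump (0 : E) := ⟨1 / 2, 1, by norm_num, by norm_num⟩
    refine ⟨B.normed μ, B.contDiff_normed, B.hasCompactSupport_normed, fun y => B.nonneg_normed y,
      B.integral_normed, fun y hy => ?_⟩
    have : y ∈ Function.support (B.normed μ) := hy
    rw [B.support_normed_eq, mem_ball_zero_iff] at this
    exact this.le
  let cf : ℕ → ℝ := fun j => -((-1) ^ (j + 1) * ((m + 2).choose (j + 1) : ℝ))
  let K : E → ℝ := fun y => ∑ j ∈ Finset.range (m + 2),
    (cf j * (((j + 1 : ℕ) : ℝ) ^ finrank ℝ E)⁻¹) * φ ((((j + 1 : ℕ) : ℝ))⁻¹ • y)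
  have hne : ∀ j : ℕ, (((j + 1 : ℕ) : ℝ))⁻¹ ≠ 0 := fun j => by positivity
  refine ⟨K, ?_, ?_, ?_⟩
  · exact ContDiff.sum fun j _ => contDiff_const.mul (hφ.comp (contDiff_const_smul _))
  · have : ∀ s : Finset ℕ, HasCompactSupport (fun y => ∑ j ∈ s,
        (cf j * (((j + 1 : ℕ) : ℝ) ^ finrank ℝ E)⁻¹) * φ ((((j + 1 : ℕ) : ℝ))⁻¹ • y)) := by
      intro s
      induction s using Finset.induction_on with
      | empty =>
        simp only [Finset.sum_empty]
        exact HasCompactSupport.zero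
      | insert a s ha ih =>
        simp only [Finset.sum_insert ha]
        exact ((hφs.comp_smul (hne a)).mul_left).add ih
    exact this _
  · intro g hg R C hC hC0 p ε hp hε hε1
    have hint : ∀ c : ℝ, Integrable (fun y => φ y * g (p - c • y)) μ := fun c =>
      mol_integrable μ φ hφ.continuous hφs c g hg p
    have e1 : mol μ K ε g p = ∑ j ∈ Finset.range (m + 2),
        cf j * ∫ y, φ y * g (p - (ε * (j + 1 : ℕ)) • y) ∂μ := by
      have hterm : ∀ j : ℕ, ∫ y, φ y * g (p - (ε * (j + 1 : ℕ)) • y) ∂μ =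
          (((j + 1 : ℕ) : ℝ) ^ finrank ℝ E)⁻¹ *
          ∫ y, φ ((((j + 1 : ℕ) : ℝ))⁻¹ • y) * g (p - ε • y) ∂μ := by
        intro j
        have h1 := Measure.integral_comp_smul μ
          (fun z => φ ((((j + 1 : ℕ) : ℝ))⁻¹ • z) * g (p - ε • z)) ((j + 1 : ℕ) : ℝ)
        rw [abs_of_nonneg (by positivity), smul_eq_mul] at h1
        rw [← h1]
        congr 1
        funext y
        rw [smul_smul, inv_mul_cancel₀ (by positivity), one_smul, smul_smul]
      simp only [mol, K, Finset.sum_mul]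
      rw [integral_finset_sum]
      · refine Finset.sum_congr rfl fun j _ => ?_
        rw [hterm, ← mul_assoc, ← integral_const_mul]
        congr 1
        funext y
        ring
      · intro j _
        have := mol_integrable μ (fun y => φ ((((j + 1 : ℕ) : ℝ))⁻¹ • y))
          (by have := hφ.continuous; fun_prop) (hφs.comp_smul (hne j)) ε g hg p
        have h2 := this.const_mul (cf j * (((j + 1 : ℕ) : ℝ) ^ finrank ℝ E)⁻¹)
        simpa only [mul_assoc] using h2
    have e2 : mol μ K ε g p - g p =
        ∫ y, φ y * (-(-1) ^ (m + 2) * (fwdDiff (-(ε • y)))^[m + 2] g p) ∂μ := by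
      have e3 : ∀ y, φ y * (-(-1) ^ (m + 2) * (fwdDiff (-(ε • y)))^[m + 2] g p) =
          (∑ j ∈ Finset.range (m + 2), cf j * (φ y * g (p - (ε * (j + 1 : ℕ)) • y)))
            - φ y * g p := by
        intro y
        have e4 : (-1 : ℝ) ^ (m + 2) * (fwdDiff (-(ε • y)))^[m + 2] g p =
            g p - ∑ j ∈ Finset.range (m + 2), cf j * g (p - (ε * (j + 1 : ℕ)) • y) := by
          rw [fwdDiff_iter_eq_sum_shift, Finset.sum_range_succ', mul_add, Finset.mul_sum, add_comm,
            sub_eq_add_neg, ← Finset.sum_neg_distrib]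
          congr 1
          · simp only [Nat.sub_zero, Nat.choose_zero_right, zero_smul, add_zero, zsmul_eq_mul]
            push_cast
            rw [mul_one, ← mul_assoc, ← pow_add, ← two_mul, pow_mul]
            norm_num
          · refine Finset.sum_congr rfl fun j hj => ?_
            rw [Finset.mem_range] at hj
            have e5 : p + (j + 1) • -(ε • y) = p - (ε * (j + 1 : ℕ)) • y := by
              rw [smul_neg, ← sub_eq_add_neg, ← Nat.cast_smul_eq_nsmul ℝ, smul_smul, mul_comm]
            have e6 : (-1 : ℝ) ^ (m + 2) * (-1) ^ (m + 1 - j) = (-1) ^ (j + 1) := by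
              have : m + 2 = (m + 1 - j) + (j + 1) := by omega
              nth_rewrite 1 [this]
              rw [pow_add, mul_right_comm, ← pow_add, ← two_mul, pow_mul]
              norm_num
            rw [e5, zsmul_eq_mul]
            push_cast
            simp only [cf]
            rw [← mul_assoc, ← mul_assoc, e6]
            ring
        rw [neg_mul, e4]
        simp only [mul_left_comm _ (φ y)]
        rw [← Finset.mul_sum]
        ring
      simp only [e3]
      rw [integral_sub, integral_finset_sum, integral_mul_const, hφ1, one_mul, e1]
      · simp only [integral_const_mul]
      · exact fun j _ => (hint _).const_mul _
      · exact integrable_finset_sum _ fun j _ => (hint _).const_mul _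
      · exact (hφ.continuous.integrable_of_hasCompactSupport hφs).mul_const _
    rw [e2, ← Real.norm_eq_abs]
    have : C * ε ^ (m + 1) = ∫ y, φ y * (C * ε ^ (m + 1)) ∂μ := by
      rw [integral_mul_const, hφ1, one_mul]
    rw [this]
    refine norm_integral_le_of_norm_le
      ((hφ.continuous.integrable_of_hasCompactSupport hφs).mul_const _)
      (Filter.Eventually.of_forall fun y => ?_)
    rw [norm_mul, Real.norm_of_nonneg (hφ0 y), norm_mul, norm_neg, norm_pow, norm_neg, norm_one,
      one_pow, one_mul, Real.norm_eq_abs]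
    by_cases hy : φ y = 0
    · simp [hy]
    · refine mul_le_mul_of_nonneg_left ?_ (hφ0 y)
      have hn : ‖-(ε • y)‖ ≤ ε := by
        rw [norm_neg, norm_smul, Real.norm_of_nonneg hε.le]
        exact mul_le_of_le_one_right hε.le (hφb y hy)
      refine (hC p _ hp (hn.trans hε1)).trans ?_
      gcongr

end mollify

section assembly

open MeasureTheory

variable {E : Type*} [NormedAddCommGroup E] [NormedSpace ℝ E] [FiniteDimensional ℝ E]
  [MeasurableSpace E] [BorelSpace E] (μ : Measure E) [μ.IsAddHaarMeasure]

/-- Dyadic scales. -/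
noncomputable def ep (j : ℕ) : ℝ := ((2 : ℝ) ^ j)⁻¹

lemma ep_pos (j : ℕ) : 0 < ep j := by unfold ep; positivity

lemma ep_le_one (j : ℕ) : ep j ≤ 1 := by
  unfold ep
  exact inv_le_one_of_one_le₀ (one_le_pow₀ (by norm_num))

/-- Dyadic pieces. -/
noncomputable def wj (K g : E → ℝ) (j : ℕ) (q : E) : ℝ :=
  mol μ K (ep j) g q - mol μ K (ep (j + 1)) g q

/-- Terms of the dyadic series. -/
noncomputable def XX (K g ψ : E → ℝ) (l : ℕ) : ℕ → E → ℝ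
  | 0, p => mol μ ψ 1 (mol μ K 1 g) p
  | j + 1, p => -(((2 : ℝ) ^ j) ^ l * mol μ ψ (ep j) (wj μ K g j) p
      + ((2 : ℝ) ^ (j + 1)) ^ l * mol μ ψ (ep (j + 1)) (wj μ K g j) p)

lemma wj_continuous (K g : E → ℝ) (hK : ContDiff ℝ (⊤ : ℕ∞) K)
    (hKs : HasCompactSupport K) (hg : Continuous g)
    (j : ℕ) : Continuous (wj μ K g j) := by
  unfold wj
  exact (mol_continuous μ K hK hKs _ (ep_pos j).ne' g hg).sub
    (mol_continuous μ K hK hKs _ (ep_pos (j + 1)).ne' g hg)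

lemma XX_deriv (K g : E → ℝ) (hK : ContDiff ℝ (⊤ : ℕ∞) K)
    (hKs : HasCompactSupport K) (hg : Continuous g)
    (ψ : E → ℝ) (hψ : ContDiff ℝ (⊤ : ℕ∞) ψ) (hs : HasCompactSupport ψ) (l j : ℕ)
    (p e : E) (s : ℝ) :
    HasDerivAt (fun s : ℝ => XX μ K g ψ l j (p + s • e))
      (XX μ K g (dirD e ψ) (l + 1) j (p + s • e)) s := by
  cases j with
  | zero =>
    have := mol_hasDerivAt μ ψ hψ hs 1 one_ne_zero (mol μ K 1 g)
      (mol_continuous μ K hK hKs _ one_ne_zero g hg) p e s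
    simpa [XX] using this
  | succ j =>
    have h1 := mol_hasDerivAt μ ψ hψ hs (ep j) (ep_pos j).ne' (wj μ K g j)
      (wj_continuous μ K g hK hKs hg j) p e s
    have h2 := mol_hasDerivAt μ ψ hψ hs (ep (j + 1)) (ep_pos (j + 1)).ne' (wj μ K g j)
      (wj_continuous μ K g hK hKs hg j) p e s
    have := ((h1.const_mul (((2 : ℝ) ^ j) ^ l)).add
      (h2.const_mul (((2 : ℝ) ^ (j + 1)) ^ l))).neg
    refine this.congr_deriv ?_
    simp only [XX, ep, inv_inv]
    ring

lemma XX_bound (K g : E → ℝ) (hK : ContDiff ℝ (⊤ : ℕ∞) K)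
    (hKs : HasCompactSupport K) (hg : Continuous g)
    (m : ℕ) (hw : ∀ R : ℝ, ∃ M, 0 ≤ M ∧ ∀ j q, ‖q‖ ≤ R →
      |wj μ K g j q| ≤ M / ((2 : ℝ) ^ j) ^ (m + 1))
    (ψ : E → ℝ) (hψ : ContDiff ℝ (⊤ : ℕ∞) ψ) (hs : HasCompactSupport ψ) (l : ℕ) (R : ℝ) :
    ∃ C, 0 ≤ C ∧ ∀ j p, ‖p‖ ≤ R →
      |XX μ K g ψ l j p| ≤ C * ((2 : ℝ) ^ j) ^ l / ((2 : ℝ) ^ j) ^ (m + 1) := by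
  haveI : ProperSpace E := FiniteDimensional.proper ℝ E
  have hc : Continuous (mol μ ψ 1 (mol μ K 1 g)) :=
    mol_continuous μ ψ hψ hs _ one_ne_zero _ (mol_continuous μ K hK hKs _ one_ne_zero g hg)
  obtain ⟨A, hA⟩ := (isCompact_closedBall (0 : E) R).exists_bound_of_continuousOn hc.continuousOn
  obtain ⟨I, ρ, hI, hρ, hb⟩ := mol_bound μ ψ hψ.continuous hs
  obtain ⟨M, hM, hwM⟩ := hw (R + ρ)
  refine ⟨|A| + 2 * (I * M) * 2 ^ (m + 1), by positivity, ?_⟩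
  intro j p hp
  cases j with
  | zero =>
    have := hA p (by simpa using hp)
    rw [Real.norm_eq_abs] at this
    simp only [XX, pow_zero, one_pow, mul_one, div_one]
    have h0 : 0 ≤ 2 * (I * M) * 2 ^ (m + 1) := by positivity
    linarith [le_abs_self A]
  | succ j =>
    have h1 := hb (wj μ K g j) R _ (ep j) (ep_pos j) (ep_le_one j) (hwM j) p hp
    have h2 := hb (wj μ K g j) R _ (ep (j + 1)) (ep_pos _) (ep_le_one _) (hwM j) p hp
    simp only [XX]
    rw [abs_neg]
    have h3 : ((2 : ℝ) ^ j) ^ l ≤ ((2 : ℝ) ^ (j + 1)) ^ l := by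
      gcongr <;> norm_num
    calc _ ≤ |((2 : ℝ) ^ j) ^ l * mol μ ψ (ep j) (wj μ K g j) p|
          + |((2 : ℝ) ^ (j + 1)) ^ l * mol μ ψ (ep (j + 1)) (wj μ K g j) p| := abs_add_le _ _
      _ ≤ ((2 : ℝ) ^ (j + 1)) ^ l * (I * (M / ((2 : ℝ) ^ j) ^ (m + 1)))
          + ((2 : ℝ) ^ (j + 1)) ^ l * (I * (M / ((2 : ℝ) ^ j) ^ (m + 1))) := by
        rw [abs_mul, abs_mul, abs_of_nonneg (by positivity : (0 : ℝ) ≤ ((2 : ℝ) ^ j) ^ l),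
          abs_of_nonneg (by positivity : (0 : ℝ) ≤ ((2 : ℝ) ^ (j + 1)) ^ l)]
        gcongr
      _ = (2 * (I * M) * 2 ^ (m + 1)) * ((2 : ℝ) ^ (j + 1)) ^ l
            / ((2 : ℝ) ^ (j + 1)) ^ (m + 1) := by
        rw [pow_succ 2 j, mul_pow _ _ (m + 1)]
        field_simp
        ring
      _ ≤ _ := by
        gcongr
        linarith [abs_nonneg A]

lemma XX_tele (K g : E → ℝ) (hK : ContDiff ℝ (⊤ : ℕ∞) K)
    (hKs : HasCompactSupport K) (hg : Continuous g)
    (j : ℕ) (p : E) :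
    XX μ K g K 0 (j + 1) p = mol μ K (ep (j + 1)) (mol μ K (ep (j + 1)) g) p
      - mol μ K (ep j) (mol μ K (ep j) g) p := by
  have c1 := mol_continuous μ K hK hKs _ (ep_pos j).ne' g hg
  have c2 := mol_continuous μ K hK hKs _ (ep_pos (j + 1)).ne' g hg
  have h1 := mol_sub μ K hK.continuous hKs (ep j) _ _ c1 c2 p
  have h2 := mol_sub μ K hK.continuous hKs (ep (j + 1)) _ _ c1 c2 p
  have h3 := mol_comm μ K K hK.continuous hKs hK.continuous hKs (ep j) (ep (j + 1)) g hg p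
  have e : wj μ K g j = fun q => mol μ K (ep j) g q - mol μ K (ep (j + 1)) g q := rfl
  simp only [XX, pow_zero, one_mul]
  rw [e, h1, h2, h3]
  ring

lemma XX_sum (K g : E → ℝ) (hK : ContDiff ℝ (⊤ : ℕ∞) K)
    (hKs : HasCompactSupport K) (hg : Continuous g)
    (j : ℕ) (p : E) :
    ∑ i ∈ Finset.range (j + 1), XX μ K g K 0 i p = mol μ K (ep j) (mol μ K (ep j) g) p := by
  induction j with
  | zero => simp [XX, ep]
  | succ j ih =>
    rw [Finset.sum_range_succ, ih, XX_tele μ K g hK hKs hg]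
    ring

end assembly

lemma two_pow_summable (C : ℝ) (l m : ℕ) (h : l ≤ m) :
    Summable fun j : ℕ => C * ((2 : ℝ) ^ j) ^ l / ((2 : ℝ) ^ j) ^ (m + 1) := by
  have h1 : Summable fun j : ℕ => |C| * (1 / 2 : ℝ) ^ j :=
    (summable_geometric_of_lt_one (by norm_num) (by norm_num)).mul_left _
  refine Summable.of_norm_bounded h1 fun j => ?_
  have hp : (1 : ℝ) ≤ 2 ^ j := one_le_pow₀ (by norm_num)
  rw [norm_div, norm_mul, Real.norm_eq_abs, Real.norm_of_nonneg (by positivity),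
    Real.norm_of_nonneg (by positivity), mul_div_assoc]
  refine mul_le_mul_of_nonneg_left ?_ (abs_nonneg _)
  rw [one_div, inv_pow, pow_succ, div_le_iff₀ (by positivity)]
  calc ((2 : ℝ) ^ j) ^ l ≤ ((2 : ℝ) ^ j) ^ m := pow_le_pow_right₀ hp h
    _ = _ := by field_simp

open MeasureTheory in
lemma plane_main (m : ℕ) (hm : 1 ≤ m) (g : ℝ × ℝ → ℝ)
    (hgc : ∀ c : ℝ → ℝ × ℝ, ContDiff ℝ (⊤ : ℕ∞) c → ZygmundClassR m (g ∘ c)) :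
    (∀ t, DifferentiableAt ℝ (fun s => g (t, s)) 0) ∧
      ZygmundClassR (m - 1) (fun t => deriv (fun s => g (t, s)) 0) := by
  obtain ⟨n, rfl⟩ : ∃ n, m = n + 1 := ⟨m - 1, by omega⟩
  have hg : Continuous g := continuous_of_curves g fun c hc => (hgc c hc).1.continuous
  obtain ⟨K, hK, hKs, hker⟩ := kernel_exists (volume : Measure (ℝ × ℝ)) (n + 1)
  set μ := (volume : Measure (ℝ × ℝ))
  have happ : ∀ R : ℝ, ∃ C, 0 ≤ C ∧ ∀ j p, ‖p‖ ≤ R →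
      |mol μ K (ep j) g p - g p| ≤ C * ep j ^ (n + 1 + 1) := by
    intro R
    obtain ⟨C, hC, h⟩ := compact_diff_bound (n + 1) g hgc R 1
    exact ⟨C, hC, fun j p hp => hker g hg R C h hC p (ep j) hp (ep_pos j) (ep_le_one j)⟩
  have hep : ∀ j, ep (j + 1) ≤ ep j := by
    intro j
    unfold ep
    gcongr <;> norm_num
  have hw : ∀ R : ℝ, ∃ M, 0 ≤ M ∧ ∀ j q, ‖q‖ ≤ R →
      |wj μ K g j q| ≤ M / ((2 : ℝ) ^ j) ^ (n + 1 + 1) := by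
    intro R
    obtain ⟨C, hC, h⟩ := happ R
    refine ⟨2 * C, by positivity, fun j q hq => ?_⟩
    have h1 := h j q hq
    have h2 := h (j + 1) q hq
    have h3 : C * ep (j + 1) ^ (n + 1 + 1) ≤ C * ep j ^ (n + 1 + 1) := by
      have := hep j
      have := (ep_pos (j + 1)).le
      gcongr
    have h4 : 2 * C / ((2 : ℝ) ^ j) ^ (n + 1 + 1) = 2 * (C * ep j ^ (n + 1 + 1)) := by
      unfold ep
      rw [inv_pow]
      ring
    rw [h4]
    unfold wj
    rw [abs_le] at *
    constructor <;> linarith [h1.1, h1.2, h2.1, h2.2]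
  have hbd := fun ψ hψ hs l R => XX_bound μ K g hK hKs hg (n + 1) hw ψ hψ hs l R
  -- pointwise convergence
  have hsum : ∀ p, g p = ∑' j, XX μ K g K 0 j p := by
    intro p
    obtain ⟨C, hC, h⟩ := hbd K hK hKs 0 ‖p‖
    have hs : Summable fun j => XX μ K g K 0 j p :=
      Summable.of_norm_bounded (two_pow_summable C 0 (n + 1) (by omega)) fun j => h j p le_rfl
    have h1 := (Filter.tendsto_add_atTop_iff_nat 1).2 hs.hasSum.tendsto_sum_nat
    simp only [XX_sum μ K g hK hKs hg] at h1
    refine tendsto_nhds_unique ?_ h1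
    obtain ⟨I, ρ, hI, hρ, hb⟩ := mol_bound μ K hK.continuous hKs
    obtain ⟨D, hD, hap⟩ := happ (‖p‖ + ρ)
    have hz : Filter.Tendsto (fun j : ℕ => (I + 1) * (D * ep j)) Filter.atTop (nhds 0) := by
      have : Filter.Tendsto ep Filter.atTop (nhds 0) := by
        have := tendsto_pow_atTop_nhds_zero_of_lt_one (r := (1 / 2 : ℝ)) (by norm_num)
          (by norm_num)
        refine this.congr fun j => ?_
        simp [ep]
      simpa using (this.const_mul D).const_mul (I + 1)
    rw [tendsto_iff_norm_sub_tendsto_zero]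
    refine squeeze_zero (fun _ => norm_nonneg _) (fun j => ?_) hz
    have c1 := mol_continuous μ K hK hKs _ (ep_pos j).ne' g hg
    have e1 := mol_sub μ K hK.continuous hKs (ep j) _ _ c1 hg p
    have hle : ∀ q, ‖q‖ ≤ ‖p‖ + ρ → |mol μ K (ep j) g q - g q| ≤ D * ep j := by
      intro q hq
      refine (hap j q hq).trans ?_
      refine mul_le_mul_of_nonneg_left ?_ hD
      exact pow_le_of_le_one (ep_pos j).le (ep_le_one j) (by omega)
    have e2 := hb (fun q => mol μ K (ep j) g q - g q) ‖p‖ (D * ep j) (ep j) (ep_pos j)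
      (ep_le_one j) hle p le_rfl
    have e3 := hle p (by linarith)
    rw [e1] at e2
    rw [Real.norm_eq_abs]
    rw [abs_le] at *
    constructor <;> linarith [e2.1, e2.2, e3.1, e3.2]
  let e1 : ℝ × ℝ := (1, 0)
  let e2 : ℝ × ℝ := (0, 1)
  let κ : ℕ → ℝ × ℝ → ℝ := fun k => (dirD e1)^[k] (dirD e2 K)
  have hκ : ∀ k, ContDiff ℝ (⊤ : ℕ∞) (κ k) ∧ HasCompactSupport (κ k) := by
    intro k
    induction k with
    | zero => exact ⟨dirD_contDiff e2 K hK, dirD_compact e2 K hKs⟩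
    | succ k ih =>
      simp only [κ, Function.iterate_succ', Function.comp]
      exact ⟨dirD_contDiff e1 _ ih.1, dirD_compact e1 _ ih.2⟩
  have hκs : ∀ k, κ (k + 1) = dirD e1 (κ k) := by
    intro k
    simp only [κ, Function.iterate_succ', Function.comp]
  let Φ : ℕ → ℕ → ℝ → ℝ := fun j k t => XX μ K g (κ k) (k + 1) j (t, 0)
  have hderiv : ∀ t, HasDerivAt (fun s => g (t, s)) (∑' j, Φ j 0 t) 0 := by
    intro t
    obtain ⟨C, hC, h⟩ := hbd (dirD e2 K) (hκ 0).1 (hκ 0).2 1 (|t| + 1)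
    obtain ⟨C', hC', h'⟩ := hbd K hK hKs 0 (|t| + 1)
    have hline : ∀ s : ℝ, ((t, 0) : ℝ × ℝ) + s • e2 = (t, s) := by
      intro s
      simp [e2]
    have hnorm : ∀ s : ℝ, |s| < 1 → ‖((t, s) : ℝ × ℝ)‖ ≤ |t| + 1 := by
      intro s hs
      rw [Prod.norm_mk, Real.norm_eq_abs, Real.norm_eq_abs]
      exact max_le (by linarith) (by linarith [abs_nonneg t])
    have := hasDerivAt_tsum_of_isPreconnected (𝕜 := ℝ) (t := Metric.ball (0 : ℝ) 1)
      (g := fun j s => XX μ K g K 0 j (t, s)) (g' := fun j s => XX μ K g (dirD e2 K) 1 j (t, s))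
      (two_pow_summable C 1 (n + 1) (by omega)) Metric.isOpen_ball
      (convex_ball (0 : ℝ) 1).isPreconnected (y₀ := 0) (y := 0) ?_ ?_ (by simp) ?_ (by simp)
    · have e : (fun s => g (t, s)) = fun s => ∑' j, XX μ K g K 0 j (t, s) := by
        funext s
        exact hsum (t, s)
      rw [e]
      exact this
    · intro j s hs
      have := XX_deriv μ K g hK hKs hg K hK hKs 0 j (t, 0) e2 s
      simpa only [hline, zero_add] using this
    · intro j s hs
      refine h j _ (hnorm s ?_)
      simpa using hs
    · exact Summable.of_norm_bounded (two_pow_summable C' 0 (n + 1) (by omega))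
        fun j => h' j _ (hnorm 0 (by simp))
  refine ⟨fun t => (hderiv t).differentiableAt, ?_⟩
  have e : (fun t => deriv (fun s => g (t, s)) 0) = fun t => ∑' j, Φ j 0 t := by
    funext t
    exact (hderiv t).deriv
  rw [e]
  simp only [Nat.add_sub_cancel]
  refine zyg_series n Φ ?_ ?_
  · intro j k t
    have := XX_deriv μ K g hK hKs hg (κ k) (hκ k).1 (hκ k).2 (k + 1) j (0, 0) e1 t
    have hline : ∀ s : ℝ, ((0, 0) : ℝ × ℝ) + s • e1 = (s, 0) := by
      intro s
      simp [e1]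
    simp only [hline, ← hκs] at this
    exact this
  · intro R k
    obtain ⟨C, hC, h⟩ := hbd (κ k) (hκ k).1 (hκ k).2 (k + 1) R
    refine ⟨C, fun j t ht => ?_⟩
    have := h j (t, 0) (by
      rw [Prod.norm_mk, Real.norm_eq_abs, norm_zero]
      exact max_le ht ((abs_nonneg t).trans ht))
    refine this.trans (le_of_eq ?_)
    have hp : (2 : ℝ) ^ j ≠ 0 := by positivity
    rw [pow_succ _ k, pow_succ _ (n + 1), ← mul_assoc, mul_div_mul_right _ _ hp]

lemma zyg_local (n : ℕ) (F : ℝ → ℝ)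
    (h : ∀ R : ℝ, 0 < R → ∃ G, ZygmundClassR n G ∧ ∀ t, |t| < R → G t = F t) :
    ZygmundClassR n F := by
  have hev : ∀ (R : ℝ) (G : ℝ → ℝ), (∀ t, |t| < R → G t = F t) → ∀ t, |t| < R →
      G =ᶠ[nhds t] F := by
    intro R G hG t ht
    have ho : IsOpen {t : ℝ | |t| < R} := isOpen_lt continuous_abs continuous_const
    filter_upwards [ho.mem_nhds ht] with s hs using hG s hs
  constructor
  · rw [contDiff_iff_contDiffAt]
    intro t
    obtain ⟨G, hG, hGF⟩ := h (|t| + 1) (by positivity)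
    exact (hG.1.contDiffAt).congr_of_eventuallyEq (hev _ G hGF t (by linarith)).symm
  · intro K hK
    obtain ⟨R, hR⟩ := hK.isBounded.exists_norm_le
    have hpos : 0 < |R| + 1 := by positivity
    obtain ⟨G, hG, hGF⟩ := h (|R| + 1) hpos
    obtain ⟨C, hC⟩ := hG.2 K hK
    have heq : ∀ t ∈ K, iteratedDeriv n F t = iteratedDeriv n G t := by
      intro t ht
      have h1 := hR t ht
      rw [Real.norm_eq_abs] at h1
      exact ((hev _ G hGF t (by linarith [le_abs_self R])).iteratedDeriv_eq n).symm
    refine ⟨C, fun x k hx hp hm hk => ?_⟩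
    rw [heq _ hx, heq _ hp, heq _ hm]
    exact hC x k hx hp hm hk

lemma trunc_exists (r : ℝ) (hr : 0 < r) : ∃ θ : ℝ → ℝ, ContDiff ℝ (⊤ : ℕ∞) θ ∧
    (∀ t, |t| ≤ r → θ t = t) ∧ ∀ t, |θ t| ≤ 2 * r := by
  let B : ContDiffBump (0 : ℝ) := ⟨r, 2 * r, hr, by linarith⟩
  refine ⟨fun t => B t * t, B.contDiff.mul contDiff_id, fun t ht => ?_, fun t => ?_⟩
  · have : B t = 1 := B.one_of_mem_closedBall (by simpa [B] using ht)
    simp [this]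
  · rw [abs_mul, abs_of_nonneg B.nonneg]
    by_cases h : |t| ≤ 2 * r
    · calc B t * |t| ≤ 1 * |t| := by gcongr; exact B.le_one
        _ ≤ 2 * r := by linarith
    · have : B t = 0 := B.zero_of_le_dist (by
        simp only [B, dist_zero_right, Real.norm_eq_abs]
        linarith)
      rw [this]
      linarith

lemma local_main {E : Type*} [NormedAddCommGroup E] [NormedSpace ℝ E] (m : ℕ) (hm : 1 ≤ m)
    (U : Set E) (hU : IsOpen U) (f : E → ℝ)
    (hf : ∀ c : ℝ → E, ContDiff ℝ (⊤ : ℕ∞) c → (∀ t, c t ∈ U) → ZygmundClassR m (f ∘ c))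
    (x v : ℝ → E) (hx : ContDiff ℝ (⊤ : ℕ∞) x) (hv : ContDiff ℝ (⊤ : ℕ∞) v)
    (hxU : ∀ t, x t ∈ U) (R : ℝ) (hR : 0 < R) :
    (∀ t, |t| < R → DifferentiableAt ℝ (fun s : ℝ => f (x t + s • v t)) 0) ∧
    ∃ G, ZygmundClassR (m - 1) G ∧
      ∀ t, |t| < R → G t = deriv (fun s : ℝ => f (x t + s • v t)) 0 := by
  obtain ⟨θ, hθ, hθ1, hθ2⟩ := trunc_exists R hR
  obtain ⟨δ, hδ, hδU⟩ : ∃ δ > 0, ∀ t s : ℝ, |t| ≤ 2 * R → |s| ≤ δ → x t + s • v t ∈ U := by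
    have ho : IsOpen {q : ℝ × ℝ | x q.1 + q.2 • v q.1 ∈ U} := by
      refine hU.preimage ?_
      have := hx.continuous
      have := hv.continuous
      fun_prop
    have hsub : Metric.closedBall (0 : ℝ) (2 * R) ×ˢ ({0} : Set ℝ) ⊆
        {q : ℝ × ℝ | x q.1 + q.2 • v q.1 ∈ U} := by
      rintro ⟨t, s⟩ ⟨_, hs⟩
      simp only [Set.mem_singleton_iff] at hs
      simp [hs, hxU]
    obtain ⟨A, B, hA, hB, hKA, h0B, hAB⟩ := generalized_tube_lemma
      (isCompact_closedBall (0 : ℝ) (2 * R)) isCompact_singleton ho hsub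
    obtain ⟨δ, hδ, hδB⟩ := Metric.isOpen_iff.1 hB 0 (h0B rfl)
    refine ⟨δ / 2, by positivity, fun t s ht hs => ?_⟩
    have hmem : ((t, s) : ℝ × ℝ) ∈ A ×ˢ B := ⟨hKA (by simpa using ht), hδB (by
      rw [mem_ball_zero_iff, Real.norm_eq_abs]
      show |s| < δ
      linarith)⟩
    exact hAB hmem
  obtain ⟨η, hη, hη1, hη2⟩ := trunc_exists (δ / 2) (by positivity)
  obtain ⟨h1, h2⟩ := plane_main m hm (fun q => f (x (θ q.1) + η q.2 • v (θ q.1))) (by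
    intro c hc
    refine hf (fun t => x (θ (c t).1) + η (c t).2 • v (θ (c t).1)) ?_ ?_
    · exact (hx.comp (hθ.comp hc.fst)).add ((hη.comp hc.snd).smul (hv.comp (hθ.comp hc.fst)))
    · intro t
      refine hδU _ _ (hθ2 _) ((hη2 _).trans (by linarith)))
  have hev : ∀ t, |t| < R → (fun s : ℝ => f (x (θ t) + η s • v (θ t))) =ᶠ[nhds 0]
      fun s : ℝ => f (x t + s • v t) := by
    intro t ht
    filter_upwards [Metric.ball_mem_nhds (0 : ℝ) (by positivity : 0 < δ / 2)] with s hs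
    rw [mem_ball_zero_iff, Real.norm_eq_abs] at hs
    rw [hθ1 t ht.le, hη1 s hs.le]
  refine ⟨fun t ht => (h1 t).congr_of_eventuallyEq (hev t ht).symm, _, h2, fun t ht => ?_⟩
  exact (hev t ht).deriv_eq

/-- **Proposition 3.6.** If `m ≥ 1`, `U ⊆ ℝ^d` is open, and `f : U → ℝ` satisfies
`f ∘ c ∈ Z^{m,1}(ℝ)` for all smooth curves `c : ℝ → U`, then the directional derivative
`d_v f(x)` exists for all `(x,v) ∈ U × ℝ^d` and `t ↦ d_{v(t)} f(x(t))` belongs to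
`Z^{m-1,1}(ℝ)` for every smooth curve `(x,v) : ℝ → U × ℝ^d`. -/
theorem zygmund_directional_derivative (d m : ℕ) (hm : 1 ≤ m)
    (U : Set (EuclideanSpace ℝ (Fin d))) (hU : IsOpen U)
    (f : EuclideanSpace ℝ (Fin d) → ℝ)
    (hf : ∀ c : ℝ → EuclideanSpace ℝ (Fin d), ContDiff ℝ (⊤ : ℕ∞) c → (∀ t, c t ∈ U) →
      ZygmundClassR m (f ∘ c)) :
    (∀ x ∈ U, ∀ v : EuclideanSpace ℝ (Fin d),
        DifferentiableAt ℝ (fun t : ℝ => f (x + t • v)) 0) ∧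
      ∀ x v : ℝ → EuclideanSpace ℝ (Fin d), ContDiff ℝ (⊤ : ℕ∞) x → ContDiff ℝ (⊤ : ℕ∞) v →
        (∀ t, x t ∈ U) →
        ZygmundClassR (m - 1) (fun t => deriv (fun s : ℝ => f (x t + s • v t)) 0) := by
  constructor
  · intro x hx v
    exact (local_main m hm U hU f hf (fun _ => x) (fun _ => v) contDiff_const contDiff_const
      (fun _ => hx) 1 one_pos).1 0 (by simp)
  · intro x v hx hv hxU
    exact zyg_local (m - 1) _ fun R hR => (local_main m hm U hU f hf x v hx hv hxU R hR).2
end
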